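/- arXiv:0902.1757 — 2 statements merged into one kernel-verified Lean document; each statement's English description precedes it below -/
import Mathlib

section
/- Let ℓ ≥ 1 be an integer. Let ε_n → 0 with ε_n ≥ d/n for some constant d > 0 and all n, and let angles satisfy 0 ≤ φ_n^(1) < φ_n^(2) < … < φ_n^(ℓ) < 2π − δ₀ for some δ₀ > 0 and all n. Suppose that for all i ≠ j, log|φ_n^(j) − φ_n^(i)| / log ε_n converges as n → ∞ to some c_{i,j} ∈ [0,∞]. Let u_n be distributed according to Haar probability measure on the unitary group U(n). Then the random vector ( (−log ε_n)^{−1/2} · log Z(u_n, e^{ε_n + i φ_n^(k)}) )_{1≤k≤ℓ} converges in distribution, as n → ∞, to a centered complex Gaussian vector (Y₁,…,Y_ℓ) with cov(Y_i,Y_j) = 1 if i = j and cov(Y_i,Y_j) = min(c_{i,j}, 1) if i ≠ j. -/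
open MeasureTheory Filter
open scoped ENNReal Topology ComplexConjugate

attribute [local instance] Classical.propDecidable

noncomputable instance (n : ℕ) : MeasurableSpace (Matrix (Fin n) (Fin n) ℂ) := borel _

/-- `log Z(u, e^{ε+iφ}) = -∑_{j≥1} Tr(u^j) e^{-j(ε+iφ)} / j`, the principal logarithm of
the characteristic polynomial `det(Id - X⁻¹u)` at `X = e^{ε+iφ}` (for `ε > 0`). -/
noncomputable def logZ (n : ℕ) (u : Matrix.unitaryGroup (Fin n) ℂ) (ε φ : ℝ) : ℂ :=
  -∑' j : ℕ, Matrix.trace ((u : Matrix (Fin n) (Fin n) ℂ) ^ (j + 1)) *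
      Complex.exp (-((j : ℂ) + 1) * (ε + φ * Complex.I)) / ((j : ℂ) + 1)

/-- The law of a standard complex normal variable. -/
noncomputable def stdComplexNormal : Measure ℂ :=
  ((ProbabilityTheory.gaussianReal 0 (1/2)).prod (ProbabilityTheory.gaussianReal 0 (1/2))).map
    (fun p => (p.1 : ℂ) + p.2 * Complex.I)

/-- The law of a centered complex normal variable with variance `v`. -/
noncomputable def complexNormal (v : ℝ) : Measure ℂ :=
  stdComplexNormal.map (fun z => (Real.sqrt v : ℂ) * z)

/-- `γ` is the law of a centered complex Gaussian vector with covariance matrix `C`. -/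
def IsCenteredComplexGaussianVector {ℓ : ℕ} (γ : Measure (Fin ℓ → ℂ))
    (C : Fin ℓ → Fin ℓ → ℂ) : Prop :=
  IsProbabilityMeasure γ ∧
  ∀ μ : Fin ℓ → ℂ, γ.map (fun z => ∑ i, μ i * z i)
      = complexNormal (∑ i, ∑ j, conj (μ i) * C i j * μ j).re

namespace UnitaryCLT

variable {n : ℕ}

instance borelSpace_matrix (n : ℕ) : BorelSpace (Matrix (Fin n) (Fin n) ℂ) := ⟨rfl⟩

/-- The unitary group `U(n)`. -/
abbrev U (n : ℕ) := Matrix.unitaryGroup (Fin n) ℂ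

instance compactSpace_unitary (n : ℕ) : CompactSpace (U n) := by
  have h1 : IsCompact {M : Matrix (Fin n) (Fin n) ℂ | ∀ i j, M i j ∈ Metric.closedBall (0 : ℂ) 1} := by
    have := isCompact_univ_pi (X := fun _ : Fin n => Fin n → ℂ)
      (s := fun _ => Set.univ.pi fun _ => Metric.closedBall (0 : ℂ) 1)
      (fun _ => isCompact_univ_pi fun _ => isCompact_closedBall _ _)
    refine (congrArg IsCompact (Set.ext fun M => ?_)).mp this
    exact ⟨fun h i j => h i trivial j trivial, fun h i _ j _ => h i j⟩
  have h2 : IsClosed {M : Matrix (Fin n) (Fin n) ℂ | star M * M = 1 ∧ M * star M = 1} := by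
    refine IsClosed.inter (isClosed_eq ?_ continuous_const) (isClosed_eq ?_ continuous_const)
    · exact (Continuous.star continuous_id).matrix_mul continuous_id
    · exact continuous_id.matrix_mul (Continuous.star continuous_id)
  refine isCompact_iff_compactSpace.mp (h1.of_isClosed_subset (s := _) h2 ?_)
  rintro M hM i j
  have := entry_norm_bound_of_unitary (𝕜 := ℂ) (U := M) hM i j
  simpa using this

lemma integrable_of_continuous (μ : Measure (U n)) [IsFiniteMeasure μ] {E : Type*}
    [NormedAddCommGroup E] [SecondCountableTopology E] {f : U n → E} (hf : Continuous f) : Integrable f μ := by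
  obtain ⟨C, hC⟩ := isCompact_univ.exists_bound_of_continuousOn hf.continuousOn
  borelize E
  exact Integrable.of_bound hf.measurable.aestronglyMeasurable C (.of_forall fun u => hC u trivial)

lemma continuous_matrix_pow (k : ℕ) : Continuous fun u : U n => (u : Matrix (Fin n) (Fin n) ℂ) ^ k := by
  induction k with
  | zero => simpa using continuous_const
  | succ k ih => simp only [pow_succ]; exact ih.matrix_mul continuous_subtype_val

lemma integral_translate {E : Type*} [NormedAddCommGroup E] [NormedSpace ℝ E]
    [SecondCountableTopology E] {μ : Measure (U n)}
    (hinv : ∀ g : U n, μ.map (fun u => g * u) = μ) (g : U n)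
    {f : U n → E} (hf : Continuous f) : ∫ u, f (g * u) ∂μ = ∫ u, f u ∂μ := by
  borelize E
  conv_rhs => rw [← hinv g]
  have hc : Continuous fun u : U n => g * u :=
    Continuous.subtype_mk (continuous_const.matrix_mul continuous_subtype_val) _
  rw [integral_map hc.measurable.aemeasurable hf.measurable.aestronglyMeasurable]

/-- A function with constant average along a curve has derivative of zero average. -/
lemma integral_deriv_eq_zero {μ : Measure (U n)} [IsFiniteMeasure μ]
    (hinv : ∀ g : U n, μ.map (fun u => g * u) = μ) {F F' : U n → ℂ} (hF : Continuous F)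
    (hF' : Continuous F') (g : ℝ → U n)
    (hd : ∀ t u, HasDerivAt (fun s => F (g s * u)) (F' (g t * u)) t) :
    ∫ u, F' u ∂μ = 0 := by
  obtain ⟨C, hC⟩ := isCompact_univ.exists_bound_of_continuousOn hF'.continuousOn
  have hc (t : ℝ) : Continuous fun u : U n => g t * u :=
    Continuous.subtype_mk (continuous_const.matrix_mul continuous_subtype_val) _
  have key := hasDerivAt_integral_of_dominated_loc_of_deriv_le (μ := μ) (𝕜 := ℝ)
    (F := fun t u => F (g t * u)) (F' := fun t u => F' (g t * u)) (x₀ := 0) (s := Set.univ)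
    (bound := fun _ => C) Filter.univ_mem
    (.of_forall fun t => (hF.comp (hc t)).measurable.aestronglyMeasurable)
    (integrable_of_continuous μ (hF.comp (hc 0)))
    (hF'.comp (hc 0)).measurable.aestronglyMeasurable
    (.of_forall fun u t _ => hC _ trivial) (integrable_const _)
    (.of_forall fun u t _ => hd t u)
  have h2 := key.2
  simp only [integral_translate hinv _ hF, integral_translate hinv _ hF'] at h2
  exact h2.unique (hasDerivAt_const _ _)

/-- Linear functionals on matrices vanishing at orthogonal projections vanish. -/
lemma eq_zero_of_projections (L : Matrix (Fin n) (Fin n) ℂ →ₗ[ℂ] ℂ)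
    (hL : ∀ P : Matrix (Fin n) (Fin n) ℂ, P.conjTranspose = P → P * P = P → L P = 0)
    (a b : Fin n) : L (Matrix.single a b 1) = 0 := by
  have hdiag (a : Fin n) : L (Matrix.single a a 1) = 0 := by
    apply hL <;> simp
  by_cases hab : a = b
  · subst hab; exact hdiag a
  have hz (z : ℂ) (hz : z * conj z = 1) :
      z * L (Matrix.single a b 1) + conj z * L (Matrix.single b a 1) = 0 := by
    have := hL ((1 / 2 : ℂ) • (Matrix.single a a 1 + Matrix.single b b 1 + z • Matrix.single a b 1
      + conj z • Matrix.single b a 1)) ?_ ?_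
    · simp only [map_smul, map_add, hdiag, smul_eq_mul, zero_add, mul_eq_zero] at this
      exact this.resolve_left (by norm_num)
    · simp [Matrix.conjTranspose_add]
      abel
    · have hz' : conj z * z = 1 := by rw [mul_comm]; exact hz
      have hba : b ≠ a := fun h => hab h.symm
      simp only [mul_add, add_mul, Matrix.smul_mul, Matrix.mul_smul,
        Matrix.single_mul_single_same, Matrix.single_mul_single_of_ne _ _ _ _ hab,
        Matrix.single_mul_single_of_ne _ _ _ _ hba, smul_zero, mul_one,
        add_zero, zero_add, smul_add]
      match_scalars <;> first | ring1 | linear_combination (1 / 4 : ℂ) * hz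
  have h1 := hz 1 (by simp)
  have h2 := hz Complex.I (by simp)
  simp only [map_one, one_mul, Complex.conj_I] at h1 h2
  have h3 : Complex.I * (L (Matrix.single a b 1) - L (Matrix.single b a 1)) = 0 := by
    linear_combination h2
  have h4 := (mul_eq_zero.mp h3).resolve_left Complex.I_ne_zero
  linear_combination (1 / 2 : ℂ) * h1 + (1 / 2 : ℂ) * h4

/-- The unitary one-parameter group `1 + (e^{it} - 1) P` attached to an orthogonal projection. -/
noncomputable def projFlow (P : Matrix (Fin n) (Fin n) ℂ) (h1 : P.conjTranspose = P)
    (h2 : P * P = P) (t : ℝ) : U n :=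
  ⟨1 + (Complex.exp (t * Complex.I) - 1) • P, by
    have hz : Complex.exp (t * Complex.I) * conj (Complex.exp (t * Complex.I)) = 1 := by
      rw [Complex.mul_conj, Complex.normSq_eq_norm_sq, Complex.norm_exp_ofReal_mul_I]; simp
    rw [Matrix.mem_unitaryGroup_iff, Matrix.star_eq_conjTranspose, Matrix.conjTranspose_add,
      Matrix.conjTranspose_smul, h1, Matrix.conjTranspose_one]
    simp only [mul_add, add_mul, one_mul, mul_one, Matrix.smul_mul, Matrix.mul_smul, h2, smul_smul]
    set z := Complex.exp (t * Complex.I)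
    have : star (z - 1) = conj z - 1 := by simp
    rw [this, add_assoc, ← add_smul, ← add_smul]
    rw [show z - 1 + ((conj z - 1) + (conj z - 1) * (z - 1)) = 0 by linear_combination hz]
    simp⟩

lemma hasDerivAt_projFlow (P : Matrix (Fin n) (Fin n) ℂ) (h1 : P.conjTranspose = P)
    (h2 : P * P = P) (u : U n) (t : ℝ) (a b : Fin n) :
    HasDerivAt (fun s : ℝ => ((projFlow P h1 h2 s * u : U n) : Matrix (Fin n) (Fin n) ℂ) a b)
      (((Complex.I • P) * ((projFlow P h1 h2 t * u : U n) : Matrix (Fin n) (Fin n) ℂ)) a b) t := by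
  have hv (s : ℝ) : ((projFlow P h1 h2 s * u : U n) : Matrix (Fin n) (Fin n) ℂ) =
      u.1 + (Complex.exp (s * Complex.I) - 1) • (P * u.1) := by
    simp [projFlow, add_mul]
  have h3 : (Complex.I • P) * ((projFlow P h1 h2 t * u : U n) : Matrix (Fin n) (Fin n) ℂ) =
      (Complex.exp (t * Complex.I) * Complex.I) • (P * u.1) := by
    rw [hv, mul_add, Matrix.smul_mul, Matrix.smul_mul, Matrix.mul_smul, ← mul_assoc, h2, smul_smul,
      ← add_smul]
    congr 1; ring
  rw [h3]
  simp only [hv, Matrix.add_apply, Matrix.smul_apply, smul_eq_mul]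
  have h4 : HasDerivAt (fun s : ℝ => Complex.exp (s * Complex.I))
      (Complex.exp (t * Complex.I) * Complex.I) t := by
    have h5 : HasDerivAt (fun s : ℝ => (s : ℂ) * Complex.I) (1 * Complex.I) t :=
      (Complex.ofRealCLM.hasDerivAt (x := t)).mul_const Complex.I
    simpa using h5.cexp
  exact ((h4.sub_const 1).mul_const _).const_add _

lemma hasDerivAt_matrix_pow {W : ℝ → Matrix (Fin n) (Fin n) ℂ} {X : Matrix (Fin n) (Fin n) ℂ}
    {t : ℝ} (hW : ∀ a b, HasDerivAt (fun s => W s a b) ((X * W t) a b) t) (k : ℕ) (a b : Fin n) :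
    HasDerivAt (fun s => (W s ^ k) a b)
      ((∑ r ∈ Finset.range k, W t ^ r * X * W t ^ (k - r)) a b) t := by
  induction k generalizing a b with
  | zero => simpa using hasDerivAt_const _ _
  | succ k ih =>
    simp only [pow_succ (W _) k, Matrix.mul_apply]
    have h := HasDerivAt.fun_sum (u := Finset.univ) fun c _ => (ih a c).mul (hW c b)
    refine h.congr_deriv ?_
    rw [Finset.sum_add_distrib, ← Matrix.mul_apply, ← Matrix.mul_apply, ← Matrix.add_apply]
    refine congrFun (congrFun (?_ : (_ : Matrix (Fin n) (Fin n) ℂ) = _) a) b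
    rw [Finset.sum_range_succ, Finset.sum_mul]
    congr 1
    · refine Finset.sum_congr rfl fun r hr => ?_
      rw [mul_assoc _ _ (W t), ← pow_succ,
        Nat.sub_add_comm (Finset.mem_range.mp hr).le]
    · simp [mul_assoc]

lemma hasDerivAt_trace_pow {W : ℝ → Matrix (Fin n) (Fin n) ℂ} {X : Matrix (Fin n) (Fin n) ℂ}
    {t : ℝ} (hW : ∀ a b, HasDerivAt (fun s => W s a b) ((X * W t) a b) t) (k : ℕ) :
    HasDerivAt (fun s => (W s ^ k).trace) (k * (X * W t ^ k).trace) t := by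
  have h := HasDerivAt.fun_sum (u := Finset.univ) fun c _ => hasDerivAt_matrix_pow hW k c c
  refine h.congr_deriv ?_
  change Matrix.trace (∑ r ∈ Finset.range k, W t ^ r * X * W t ^ (k - r)) = _
  rw [Matrix.trace_sum]
  have hr (r) (hr : r ∈ Finset.range k) : (W t ^ r * X * W t ^ (k - r)).trace =
      (X * W t ^ k).trace := by
    rw [Matrix.trace_mul_comm, ← mul_assoc, ← pow_add,
      Nat.sub_add_cancel (Finset.mem_range.mp hr).le, Matrix.trace_mul_comm]
  rw [Finset.sum_congr rfl hr, Finset.sum_const, Finset.card_range, nsmul_eq_mul]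

/-- The power trace `Tr(u^k)`. -/
noncomputable def powTr (k : ℕ) (u : U n) : ℂ := Matrix.trace ((u : Matrix (Fin n) (Fin n) ℂ) ^ k)

/-- The product of the power traces indexed by a multiset. -/
noncomputable def prodTr (l : Multiset ℕ) (u : U n) : ℂ := (l.map fun j => powTr j u).prod

lemma powTr_zero (u : U n) : powTr 0 u = n := by simp [powTr]

lemma prodTr_cons (k : ℕ) (l : Multiset ℕ) (u : U n) :
    prodTr (k ::ₘ l) u = powTr k u * prodTr l u := by simp [prodTr]

lemma prodTr_zero (u : U n) : prodTr 0 u = 1 := by simp [prodTr]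

lemma continuous_powTr (k : ℕ) : Continuous (powTr k : U n → ℂ) :=
  (continuous_matrix_pow k).matrix_trace

lemma continuous_prodTr (l : Multiset ℕ) : Continuous (prodTr l : U n → ℂ) :=
  continuous_multiset_prod _ fun j _ => continuous_powTr j

lemma norm_powTr_le (k : ℕ) (u : U n) : ‖powTr k u‖ ≤ n := by
  unfold powTr Matrix.trace
  refine (norm_sum_le _ _).trans ?_
  refine (Finset.sum_le_card_nsmul _ _ 1 fun i _ => ?_).trans (by simp)
  have := entry_norm_bound_of_unitary (𝕜 := ℂ) (u ^ k).2 i i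
  simpa using this

lemma norm_prodTr_le (l : Multiset ℕ) (u : U n) : ‖prodTr l u‖ ≤ (n : ℝ) ^ l.card := by
  induction l using Multiset.induction_on with
  | empty => simp [prodTr]
  | cons a s ih =>
    rw [prodTr_cons, norm_mul, Multiset.card_cons, pow_succ']
    exact mul_le_mul (norm_powTr_le a u) ih (norm_nonneg _) (by positivity)

lemma conj_powTr (k : ℕ) (u : U n) :
    conj (powTr k u) = Matrix.trace ((star (u : Matrix (Fin n) (Fin n) ℂ)) ^ k) := by
  rw [powTr, starRingEnd_apply, ← star_pow, Matrix.star_eq_conjTranspose,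
    Matrix.trace_conjTranspose]

/-- The derivative of `(u^k)_{ab} ∏_{j ∈ l} Tr(u^j) ∏_{j ∈ m} conj (Tr(u^j))` along the
(complexified) direction `X`. -/
noncomputable def derivMon (k : ℕ) (l m : Multiset ℕ) (a b : Fin n) (u : U n)
    (X : Matrix (Fin n) (Fin n) ℂ) : ℂ :=
  (∑ r ∈ Finset.range k, (u : Matrix (Fin n) (Fin n) ℂ) ^ r * X * u.1 ^ (k - r)) a b *
      (prodTr l u * conj (prodTr m u)) +
    (u.1 ^ k) a b *
      ((l.map fun j => prodTr (l.erase j) u * (j * (X * u.1 ^ j).trace)).sum * conj (prodTr m u)) -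
    (u.1 ^ k) a b * (prodTr l u *
      (m.map fun j => conj (prodTr (m.erase j) u) * (j * (X * (star u.1) ^ j).trace)).sum)

lemma derivMon_add (k : ℕ) (l m : Multiset ℕ) (a b : Fin n) (u : U n)
    (X Y : Matrix (Fin n) (Fin n) ℂ) :
    derivMon k l m a b u (X + Y) = derivMon k l m a b u X + derivMon k l m a b u Y := by
  simp only [derivMon, mul_add, add_mul, Matrix.trace_add, Finset.sum_add_distrib,
    Matrix.add_apply, Multiset.sum_map_add]
  ring

lemma derivMon_smul (k : ℕ) (l m : Multiset ℕ) (a b : Fin n) (u : U n)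
    (c : ℂ) (X : Matrix (Fin n) (Fin n) ℂ) :
    derivMon k l m a b u (c • X) = c * derivMon k l m a b u X := by
  have h (x y z : ℂ) : x * (y * (c * z)) = c * (x * (y * z)) := by ring
  simp only [derivMon, Matrix.smul_mul, Matrix.mul_smul, Matrix.trace_smul, ← Finset.smul_sum,
    Matrix.smul_apply, smul_eq_mul, h, Multiset.sum_map_mul_left]
  ring

lemma continuous_derivMon (k : ℕ) (l m : Multiset ℕ) (a b : Fin n)
    (X : Matrix (Fin n) (Fin n) ℂ) : Continuous fun u : U n => derivMon k l m a b u X := by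
  have h1 (k : ℕ) : Continuous fun u : U n => (u.1 ^ k) := continuous_matrix_pow k
  have h2 (k : ℕ) : Continuous fun u : U n => ((star u.1) ^ k) := by
    simp only [← star_pow]; exact (h1 k).star
  have h3 := fun l => continuous_prodTr (n := n) l
  have h4 := fun l => (Complex.continuous_conj).comp (continuous_prodTr (n := n) l)
  unfold derivMon
  refine ((Continuous.mul (Continuous.matrix_elem (continuous_finsetSum _ fun r _ =>
    ((h1 r).matrix_mul continuous_const).matrix_mul (h1 _)) a b) ((h3 l).mul (h4 m))).add
    (((h1 k).matrix_elem a b).mul (Continuous.mul (continuous_multiset_sum _ fun j _ =>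
      (h3 _).mul (continuous_const.mul (continuous_const.matrix_mul (h1 j)).matrix_trace))
        (h4 m)))).sub
    (((h1 k).matrix_elem a b).mul (Continuous.mul (h3 l) (continuous_multiset_sum _ fun j _ =>
      (h4 _).mul (continuous_const.mul (continuous_const.matrix_mul (h2 j)).matrix_trace))))

lemma hasDerivAt_multiset_prod {l : Multiset ℕ} {f : ℕ → ℝ → ℂ} {f' : ℕ → ℂ} {t : ℝ}
    (h : ∀ j, HasDerivAt (f j) (f' j) t) :
    HasDerivAt (fun s => (l.map fun j => f j s).prod)
      (l.map fun j => ((l.erase j).map fun i => f i t).prod * f' j).sum t := by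
  have := (HasFDerivAt.multiset_prod (u := l) fun j _ => (h j).hasFDerivAt).hasDerivAt
  refine this.congr_deriv ?_
  rw [← ContinuousLinearMap.apply_apply (𝕜 := ℝ) (1 : ℝ), map_multiset_sum, Multiset.map_map]
  simp [Function.comp_def]

lemma integral_derivMon {μ : Measure (U n)} [IsFiniteMeasure μ]
    (hinv : ∀ g : U n, μ.map (fun u => g * u) = μ) (k : ℕ) (l m : Multiset ℕ) (a b : Fin n) :
    ∫ u, derivMon k l m a b u (Matrix.single a b 1) ∂μ = 0 := by
  let L : Matrix (Fin n) (Fin n) ℂ →ₗ[ℂ] ℂ :=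
    { toFun := fun X => ∫ u, derivMon k l m a b u X ∂μ
      map_add' := fun X Y => by
        simp only [derivMon_add]
        exact integral_add (integrable_of_continuous μ (continuous_derivMon ..))
          (integrable_of_continuous μ (continuous_derivMon ..))
      map_smul' := fun c X => by
        simp only [derivMon_smul, RingHom.id_apply, smul_eq_mul]
        exact integral_const_mul _ _ }
  refine eq_zero_of_projections L (fun P h1 h2 => ?_) a b
  have hI : L (Complex.I • P) = 0 := by
    refine integral_deriv_eq_zero hinv
      (F := fun u => (u.1 ^ k) a b * (prodTr l u * conj (prodTr m u)))
      (((continuous_matrix_pow k).matrix_elem a b).mul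
        ((continuous_prodTr l).mul (Complex.continuous_conj.comp (continuous_prodTr m))))
      (continuous_derivMon ..) (projFlow P h1 h2) fun t u => ?_
    have hW := hasDerivAt_projFlow P h1 h2 u t
    have hp (j : ℕ) : HasDerivAt (fun s => powTr j (projFlow P h1 h2 s * u)) _ t :=
      hasDerivAt_trace_pow hW j
    have hpc (j : ℕ) := (hp j).star
    have hM := hasDerivAt_multiset_prod (l := l) hp
    have hMc := hasDerivAt_multiset_prod (l := m) hpc
    have hF := (hasDerivAt_matrix_pow hW k a b).mul (hM.mul hMc)
    have hc (w : U n) (m : Multiset ℕ) :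
        (m.map fun j => star (powTr j w)).prod = conj (prodTr m w) := by
      rw [prodTr, map_multiset_prod, Multiset.map_map]; rfl
    simp only [hc] at hF
    refine hF.congr_deriv ?_
    have hs (j : ℕ) (w : U n) : star ((j : ℂ) * ((Complex.I • P) * w.1 ^ j).trace) =
        - (j * ((Complex.I • P) * (star w.1) ^ j).trace) := by
      rw [star_mul', Matrix.smul_mul, Matrix.trace_smul, smul_eq_mul, star_mul',
        ← Matrix.trace_conjTranspose, Matrix.conjTranspose_mul, h1, Matrix.conjTranspose_pow,
        Matrix.trace_mul_comm, Matrix.smul_mul, Matrix.trace_smul, Matrix.star_eq_conjTranspose]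
      simp
    simp only [hs, derivMon]
    simp only [Pi.mul_apply, mul_neg, Multiset.sum_map_neg, prodTr]
    ring
  rw [map_smul, smul_eq_mul] at hI
  exact (mul_eq_zero.mp hI).resolve_left Complex.I_ne_zero

/-- Joint moments of the power traces and their conjugates. -/
noncomputable def mom (μ : Measure (U n)) (l m : Multiset ℕ) : ℂ :=
  ∫ u, prodTr l u * conj (prodTr m u) ∂μ

lemma mom_conj (μ : Measure (U n)) (l m : Multiset ℕ) : conj (mom μ l m) = mom μ m l := by
  rw [mom, mom, ← integral_conj]
  simp [mul_comm]

lemma norm_mom_le (μ : Measure (U n)) [IsProbabilityMeasure μ] (l m : Multiset ℕ) :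
    ‖mom μ l m‖ ≤ (n : ℝ) ^ (l.card + m.card) := by
  refine (norm_integral_le_of_norm_le_const (.of_forall fun u => ?_)).trans_eq
    (by rw [probReal_univ, mul_one])
  rw [norm_mul, RCLike.norm_conj, pow_add]
  exact mul_le_mul (norm_prodTr_le _ _) (norm_prodTr_le _ _) (norm_nonneg _) (by positivity)

/-- Multiplication by a scalar of modulus one. -/
noncomputable def scalarU (n : ℕ) (z : ℂ) (hz : z * conj z = 1) : U n :=
  ⟨z • 1, by
    rw [Matrix.mem_unitaryGroup_iff, Matrix.star_eq_conjTranspose, Matrix.conjTranspose_smul]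
    simp [smul_smul]
    rw [mul_comm, hz, one_smul]⟩

lemma prodTr_scalarU_mul {z : ℂ} (hz : z * conj z = 1) (l : Multiset ℕ) (u : U n) :
    prodTr l (scalarU n z hz * u) = z ^ l.sum * prodTr l u := by
  induction l using Multiset.induction_on with
  | empty => simp [prodTr]
  | cons a s ih =>
    have : powTr a (scalarU n z hz * u) = z ^ a * powTr a u := by
      simp [powTr, scalarU, smul_pow, Matrix.trace_smul]
    rw [prodTr_cons, prodTr_cons, ih, this, Multiset.sum_cons, pow_add]
    ring

lemma mom_eq_zero {μ : Measure (U n)} (hinv : ∀ g : U n, μ.map (fun u => g * u) = μ)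
    {l m : Multiset ℕ} (h : l.sum ≠ m.sum) : mom μ l m = 0 := by
  wlog hlt : m.sum < l.sum generalizing l m
  · rw [← mom_conj, this h.symm (lt_of_le_of_ne (not_lt.mp hlt) h), map_zero]
  set d := l.sum - m.sum with hd
  have hd0 : (d : ℂ) ≠ 0 := by rw [Nat.cast_ne_zero]; omega
  set z := Complex.exp ((Real.pi / d : ℝ) * Complex.I) with hzdef
  have hz : z * conj z = 1 := by
    rw [Complex.mul_conj, Complex.normSq_eq_norm_sq, Complex.norm_exp_ofReal_mul_I]; simp
  have hzd : z ^ d = -1 := by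
    rw [hzdef, ← Complex.exp_nat_mul, ← Complex.exp_pi_mul_I]
    congr 1; push_cast; field_simp
  have hc : Continuous fun u : U n => prodTr l u * conj (prodTr m u) :=
    (continuous_prodTr l).mul (Complex.continuous_conj.comp (continuous_prodTr m))
  have h1 := integral_translate hinv (scalarU n z hz) hc
  have h2 (u : U n) : prodTr l (scalarU n z hz * u) * conj (prodTr m (scalarU n z hz * u)) =
      -(prodTr l u * conj (prodTr m u)) := by
    rw [prodTr_scalarU_mul, prodTr_scalarU_mul, map_mul, map_pow,
      show l.sum = d + m.sum by omega, pow_add, hzd]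
    have : z ^ m.sum * conj z ^ m.sum = 1 := by rw [← mul_pow, hz, one_pow]
    linear_combination (-prodTr l u * conj (prodTr m u)) * this
  simp only [h2, integral_neg] at h1
  exact self_eq_neg.mp h1.symm

/-- `Tr(u^k u^{-j})`. -/
noncomputable def diffTr (k j : ℕ) (u : U n) : ℂ :=
  if j ≤ k then powTr (k - j) u else conj (powTr (j - k) u)

lemma trace_pow_mul_star_pow (k j : ℕ) (u : U n) :
    (u.1 ^ k * (star u.1) ^ j).trace = diffTr k j u := by
  have h (i : ℕ) : u.1 ^ i * (star u.1) ^ i = 1 := by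
    rw [← star_pow]; exact Unitary.mul_star_self_of_mem (u ^ i).2
  unfold diffTr
  split_ifs with hjk
  · obtain ⟨i, rfl⟩ := Nat.exists_eq_add_of_le' hjk
    rw [pow_add, mul_assoc, h, mul_one, Nat.add_sub_cancel, powTr]
  · obtain ⟨i, rfl⟩ := Nat.exists_eq_add_of_le (not_le.mp hjk).le
    rw [pow_add, ← mul_assoc, h, one_mul, Nat.add_sub_cancel_left, conj_powTr]

lemma sum_mul_multiset_sum (A : Matrix (Fin n) (Fin n) ℂ) (s : Multiset ℕ) (f : ℕ → ℂ)
    (B : ℕ → Matrix (Fin n) (Fin n) ℂ) :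
    ∑ a, ∑ b, A a b * (s.map fun j : ℕ => f j * B j b a).sum =
      (s.map fun j : ℕ => f j * (A * B j).trace).sum := by
  induction s using Multiset.induction_on with
  | empty => simp
  | cons i s ih =>
    simp only [Multiset.map_cons, Multiset.sum_cons, mul_add, Finset.sum_add_distrib, ih]
    congr 1
    simp only [Matrix.trace, Matrix.mul_apply, Matrix.diag_apply, Finset.mul_sum]
    exact Finset.sum_congr rfl fun a _ => Finset.sum_congr rfl fun b _ => by ring

lemma sum_derivMon (k : ℕ) (l m : Multiset ℕ) (u : U n) :
    ∑ a, ∑ b, derivMon k l m a b u (Matrix.single a b 1) =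
      (∑ r ∈ Finset.range k, powTr r u * powTr (k - r) u) * (prodTr l u * conj (prodTr m u)) +
      (l.map fun j : ℕ =>
        (j : ℂ) * (powTr (k + j) u * prodTr (l.erase j) u * conj (prodTr m u))).sum -
      (m.map fun j : ℕ =>
        (j : ℂ) * (diffTr k j u * prodTr l u * conj (prodTr (m.erase j) u))).sum := by
  have h1 (A B : Matrix (Fin n) (Fin n) ℂ) (a b : Fin n) :
      (A * Matrix.single a b 1 * B : Matrix (Fin n) (Fin n) ℂ) a b = A a a * B b b := by
    rw [mul_assoc, Matrix.mul_apply, Finset.sum_eq_single a]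
    · simp
    · intro c _ hc
      rw [Matrix.single_mul_apply_of_ne _ _ _ _ _ hc, mul_zero]
    · simp
  have h2 (B : Matrix (Fin n) (Fin n) ℂ) (a b : Fin n) :
      (Matrix.single a b 1 * B).trace = B b a := by
    rw [Matrix.trace_mul_comm, Matrix.trace_mul_single]; simp
  simp only [derivMon, Finset.sum_add_distrib, Finset.sum_sub_distrib, h2]
  congr 1
  · congr 1
    · simp only [← Finset.sum_mul]
      congr 1
      simp only [Matrix.sum_apply, h1]
      rw [Finset.sum_congr rfl fun a _ => Finset.sum_comm, Finset.sum_comm]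
      refine Finset.sum_congr rfl fun r _ => ?_
      rw [powTr, powTr, Matrix.trace, Matrix.trace, Finset.sum_mul_sum]; rfl
    · have := sum_mul_multiset_sum (u.1 ^ k) l
        (fun j => (j : ℂ) * (prodTr (l.erase j) u * conj (prodTr m u))) (fun j => u.1 ^ j)
      simp only [← pow_add] at this
      refine Eq.trans ?_ (this.trans ?_)
      · refine Finset.sum_congr rfl fun a _ => Finset.sum_congr rfl fun b _ => ?_
        rw [← Multiset.sum_map_mul_right]
        congr 3; funext j; ring
      · congr 2; funext j; rw [powTr]; ring
  · have := sum_mul_multiset_sum (u.1 ^ k) m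
      (fun j => (j : ℂ) * (prodTr l u * conj (prodTr (m.erase j) u))) (fun j => (star u.1) ^ j)
    simp only [trace_pow_mul_star_pow] at this
    refine Eq.trans ?_ (this.trans ?_)
    · refine Finset.sum_congr rfl fun a _ => Finset.sum_congr rfl fun b _ => ?_
      rw [← Multiset.sum_map_mul_left]
      congr 3; funext j; ring
    · congr 2; funext j; ring

lemma integral_multiset_sum (μ : Measure (U n)) [IsFiniteMeasure μ] (s : Multiset ℕ)
    {f : ℕ → U n → ℂ} (hf : ∀ j, Continuous (f j)) :
    ∫ u, (s.map fun j => f j u).sum ∂μ = (s.map fun j => ∫ u, f j u ∂μ).sum := by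
  induction s using Multiset.induction_on with
  | empty => simp
  | cons i s ih =>
    simp only [Multiset.map_cons, Multiset.sum_cons]
    rw [integral_add (integrable_of_continuous μ (hf i))
      (integrable_of_continuous μ (continuous_multiset_sum _ fun j _ => hf j)), ih]

lemma continuous_diffTr (k j : ℕ) : Continuous (diffTr k j : U n → ℂ) := by
  unfold diffTr
  split_ifs
  · exact continuous_powTr _
  · exact Complex.continuous_conj.comp (continuous_powTr _)

lemma continuous_conj_prodTr (m : Multiset ℕ) :
    Continuous fun u : U n => conj (prodTr m u) :=
  Complex.continuous_conj.comp (continuous_prodTr m)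

lemma integral_diffTr (μ : Measure (U n)) (k j : ℕ) (l m : Multiset ℕ) :
    ∫ u, diffTr k j u * prodTr l u * conj (prodTr m u) ∂μ =
      if j ≤ k then mom μ ((k - j) ::ₘ l) m else mom μ l ((j - k) ::ₘ m) := by
  unfold diffTr mom
  split_ifs
  · simp only [prodTr_cons]
  · simp only [prodTr_cons, map_mul]
    congr 1; funext u; ring

lemma mom_zero_cons (μ : Measure (U n)) (l m : Multiset ℕ) :
    mom μ (0 ::ₘ l) m = n * mom μ l m := by
  simp only [mom, prodTr_cons, powTr_zero, mul_assoc]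
  exact integral_const_mul _ _

/-- The Schwinger-Dyson equations for the moments of power traces. -/
lemma schwinger_dyson {μ : Measure (U n)} [IsFiniteMeasure μ]
    (hinv : ∀ g : U n, μ.map (fun u => g * u) = μ) (k : ℕ) (l m : Multiset ℕ) :
    ∑ r ∈ Finset.range k, mom μ (r ::ₘ (k - r) ::ₘ l) m +
      (l.map fun j : ℕ => (j : ℂ) * mom μ ((k + j) ::ₘ l.erase j) m).sum =
      (m.map fun j : ℕ => (j : ℂ) * if j ≤ k then mom μ ((k - j) ::ₘ l) (m.erase j)
        else mom μ l ((j - k) ::ₘ m.erase j)).sum := by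
  have h0 : ∫ u, ∑ a, ∑ b, derivMon k l m a b u (Matrix.single a b 1) ∂μ = 0 := by
    rw [integral_finsetSum _ fun a _ => integrable_of_continuous μ
      (continuous_finsetSum _ fun b _ => continuous_derivMon ..)]
    refine Finset.sum_eq_zero fun a _ => ?_
    rw [integral_finsetSum _ fun b _ => integrable_of_continuous μ (continuous_derivMon ..)]
    exact Finset.sum_eq_zero fun b _ => integral_derivMon hinv k l m a b
  simp only [sum_derivMon, Finset.sum_mul] at h0
  have c1 (r : ℕ) : Continuous fun u : U n =>
      powTr r u * powTr (k - r) u * (prodTr l u * conj (prodTr m u)) :=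
    ((continuous_powTr _).mul (continuous_powTr _)).mul
      ((continuous_prodTr l).mul (continuous_conj_prodTr m))
  have c2 (j : ℕ) : Continuous fun u : U n =>
      (j : ℂ) * (powTr (k + j) u * prodTr (l.erase j) u * conj (prodTr m u)) :=
    continuous_const.mul (((continuous_powTr _).mul (continuous_prodTr _)).mul
      (continuous_conj_prodTr m))
  have c3 (j : ℕ) : Continuous fun u : U n =>
      (j : ℂ) * (diffTr k j u * prodTr l u * conj (prodTr (m.erase j) u)) :=
    continuous_const.mul (((continuous_diffTr _ _).mul (continuous_prodTr _)).mul
      (continuous_conj_prodTr _))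
  have C1 := continuous_finsetSum (Finset.range k) fun r _ => c1 r
  have C2 := continuous_multiset_sum l fun j _ => c2 j
  have C3 := continuous_multiset_sum m fun j _ => c3 j
  replace h0 := (integral_sub ((integrable_of_continuous μ C1).add
    (integrable_of_continuous μ C2)) (integrable_of_continuous μ C3)).symm.trans h0
  rw [integral_add' (integrable_of_continuous μ C1) (integrable_of_continuous μ C2),
    integral_finsetSum _ fun r _ => integrable_of_continuous μ (c1 r),
    integral_multiset_sum μ l c2, integral_multiset_sum μ m c3] at h0
  simp only [integral_const_mul, integral_diffTr] at h0
  rw [← sub_eq_zero, ← h0]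
  congr 2
  · refine Finset.sum_congr rfl fun r _ => ?_
    simp only [mom, prodTr_cons]
    congr 1; funext u; ring
  · congr 2; funext j
    simp only [mom, prodTr_cons]

/-- The defect in the Gaussian integration by parts formula. -/
noncomputable def defect (μ : Measure (U n)) (k : ℕ) (l m : Multiset ℕ) : ℂ :=
  mom μ (k ::ₘ l) m -
    (m.map fun j : ℕ => if j = k then (k : ℂ) * mom μ l (m.erase j) else 0).sum

lemma defect_rec {μ : Measure (U n)} [IsFiniteMeasure μ]
    (hinv : ∀ g : U n, μ.map (fun u => g * u) = μ) (k : ℕ) (l m : Multiset ℕ)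
    (hm0 : 0 ∉ m)
    (ih : ∀ j ∈ m, k + 1 < j → defect μ (j - (k + 1)) (m.erase j) l = 0) :
    n * defect μ (k + 1) l m =
      -(∑ r ∈ Finset.range k, defect μ (r + 1) ((k - r) ::ₘ l) m +
        (l.map fun j : ℕ => (j : ℂ) * defect μ (k + 1 + j) (l.erase j) m).sum) := by
  have hsd := schwinger_dyson hinv (k + 1) l m
  rw [Finset.sum_range_succ'] at hsd
  simp only [mom_zero_cons, Nat.sub_zero, Nat.add_sub_add_right] at hsd
  have key : (m.map fun j : ℕ => (j : ℂ) * if j ≤ k + 1 then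
        mom μ ((k + 1 - j) ::ₘ l) (m.erase j) else mom μ l ((j - (k + 1)) ::ₘ m.erase j)).sum =
      n * (m.map fun j : ℕ => if j = k + 1 then ((k + 1 : ℕ) : ℂ) * mom μ l (m.erase j)
        else 0).sum +
      ∑ r ∈ Finset.range k, (m.map fun j : ℕ => if j = r + 1 then
        ((r + 1 : ℕ) : ℂ) * mom μ ((k - r) ::ₘ l) (m.erase j) else 0).sum +
      (l.map fun i : ℕ => (i : ℂ) * (m.map fun j : ℕ => if j = k + 1 + i then
        ((k + 1 + i : ℕ) : ℂ) * mom μ (l.erase i) (m.erase j) else 0).sum).sum := by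
    simp only [← Multiset.sum_map_mul_left]
    rw [Finset.sum_eq_multiset_sum, Multiset.sum_map_sum_map, Multiset.sum_map_sum_map l m,
      ← Multiset.sum_map_add, ← Multiset.sum_map_add]
    refine congrArg _ (Multiset.map_congr rfl fun j hj => ?_)
    change _ = _ + (∑ r ∈ Finset.range k, _) + _
    have hj0 : j ≠ 0 := fun h => hm0 (h ▸ hj)
    rcases lt_trichotomy j (k + 1) with h | h | h
    · rw [if_pos h.le, if_neg h.ne, Finset.sum_eq_single (j - 1), if_pos (by omega),
        Multiset.sum_eq_zero, mul_zero, zero_add, add_zero]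
      · rw [show k - (j - 1) = k + 1 - j by omega, show j - 1 + 1 = j by omega]
      · intro x hx
        obtain ⟨i, -, rfl⟩ := Multiset.mem_map.mp hx
        rw [if_neg (by omega), mul_zero]
      · intro r _ hr
        rw [if_neg (by omega)]
      · intro h; exact absurd (Finset.mem_range.mpr (by omega)) h
    · rw [if_pos h.le, if_pos h, h, Nat.sub_self, mom_zero_cons, Finset.sum_eq_zero,
        Multiset.sum_eq_zero]
      · ring
      · intro x hx
        obtain ⟨i, hi, rfl⟩ := Multiset.mem_map.mp hx
        by_cases hi0 : i = 0
        · simp [hi0]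
        · rw [if_neg (by omega), mul_zero]
      · intro r hr
        rw [if_neg]; have := Finset.mem_range.mp hr; omega
    · rw [if_neg (by omega), if_neg (by omega), Finset.sum_eq_zero, mul_zero, zero_add, zero_add,
        ← mom_conj, sub_eq_zero.mp (ih j hj h), map_multiset_sum, Multiset.map_map,
        ← Multiset.sum_map_mul_left]
      · refine congrArg _ (Multiset.map_congr rfl fun i _ => ?_)
        simp only [Function.comp]
        by_cases hi : i = j - (k + 1)
        · rw [if_pos hi, if_pos (by omega), map_mul, mom_conj, hi, Nat.add_sub_cancel' h.le]
          simp; ring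
        · rw [if_neg hi, if_neg (by omega)]; simp
      · intro r hr
        rw [if_neg]; have := Finset.mem_range.mp hr; omega
  simp only [defect, mul_sub, Finset.sum_sub_distrib, Multiset.sum_map_sub]
  rw [key] at hsd
  linear_combination hsd

lemma card_le_sum_of_pos {l : Multiset ℕ} (h : 0 ∉ l) : l.card ≤ l.sum := by
  have := Multiset.card_nsmul_le_sum (s := l) (a := 1) fun x hx =>
    Nat.one_le_iff_ne_zero.mpr fun h0 => h (h0 ▸ hx)
  simpa using this

lemma norm_multiset_sum_le_card (s : Multiset ℕ) (f : ℕ → ℂ) (g : ℕ → ℝ)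
    (h : ∀ j ∈ s, ‖f j‖ ≤ g j) : ‖(s.map f).sum‖ ≤ (s.map g).sum := by
  refine (norm_multiset_sum_le _).trans ?_
  rw [Multiset.map_map]
  exact Multiset.sum_map_le_sum_map _ _ h

lemma defect_eq_zero_of_sum_ne {μ : Measure (U n)}
    (hinv : ∀ g : U n, μ.map (fun u => g * u) = μ) {k : ℕ} {l m : Multiset ℕ}
    (h : k + l.sum ≠ m.sum) : defect μ k l m = 0 := by
  rw [defect, mom_eq_zero hinv (by rwa [Multiset.sum_cons]), zero_sub, neg_eq_zero]
  refine Multiset.sum_eq_zero fun x hx => ?_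
  obtain ⟨j, hj, rfl⟩ := Multiset.mem_map.mp hx
  split_ifs with hjk
  · have := Multiset.sum_erase hj
    rw [mom_eq_zero hinv (by omega), mul_zero]
  · rfl

lemma norm_defect_le {μ : Measure (U n)} [IsProbabilityMeasure μ] {k d : ℕ}
    {l m : Multiset ℕ} (hn : 1 ≤ n) (hk : 1 ≤ k) (hl : 0 ∉ l) (hm : 0 ∉ m)
    (h : k + l.sum = d) (hmd : m.sum = d) :
    ‖defect μ k l m‖ ≤ (n : ℝ) ^ (2 * d) * (1 + d * d) := by
  have hn' : (1 : ℝ) ≤ n := by exact_mod_cast hn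
  have hcl := card_le_sum_of_pos hl
  have hcm := card_le_sum_of_pos hm
  have h1 : ‖mom μ (k ::ₘ l) m‖ ≤ (n : ℝ) ^ (2 * d) :=
    (norm_mom_le _ _ _).trans (pow_le_pow_right₀ hn' (by rw [Multiset.card_cons]; omega))
  have h2 : ‖(m.map fun j : ℕ => if j = k then (k : ℂ) * mom μ l (m.erase j) else 0).sum‖ ≤
      (m.map fun _ : ℕ => (d : ℝ) * (n : ℝ) ^ (2 * d)).sum := by
    refine norm_multiset_sum_le_card _ _ _ fun j _ => ?_
    split_ifs
    · rw [norm_mul, Complex.norm_natCast]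
      have := Multiset.card_le_card (Multiset.erase_le j m)
      exact mul_le_mul (by exact_mod_cast (by omega)) ((norm_mom_le _ _ _).trans
        (pow_le_pow_right₀ hn' (by omega))) (norm_nonneg _) (by positivity)
    · rw [norm_zero]; positivity
  rw [Multiset.map_const', Multiset.sum_replicate, nsmul_eq_mul] at h2
  have h3 : (m.card : ℝ) ≤ d := by exact_mod_cast (by omega)
  have h4 : (m.card : ℝ) * ((d : ℝ) * (n : ℝ) ^ (2 * d)) ≤ d * (d * (n : ℝ) ^ (2 * d)) :=
    mul_le_mul_of_nonneg_right h3 (by positivity)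
  refine (norm_sub_le _ _).trans ?_
  linarith

/-- Exact Gaussian integration by parts for power traces in degree at most `n`. -/
lemma defect_eq_zero {μ : Measure (U n)} [IsProbabilityMeasure μ]
    (hinv : ∀ g : U n, μ.map (fun u => g * u) = μ) {k : ℕ} {l m : Multiset ℕ}
    (hk : 1 ≤ k) (hl : 0 ∉ l) (hm : 0 ∉ m) (h : k + l.sum ≤ n) : defect μ k l m = 0 := by
  obtain ⟨d, hd⟩ : ∃ d, k + l.sum = d := ⟨_, rfl⟩
  induction d using Nat.strong_induction_on generalizing k l m with
  | _ d ih =>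
  by_cases hmd : m.sum = d
  swap
  · exact defect_eq_zero_of_sum_ne hinv (by omega)
  have hn : 1 ≤ n := by omega
  have hn' : (0 : ℝ) < n := by exact_mod_cast hn
  set B : ℝ := (n : ℝ) ^ (2 * d) * (1 + d * d)
  set x : ℝ := ((d - 1 : ℕ) : ℝ) / n
  have key (q : ℕ) : ∀ k l, 1 ≤ k → 0 ∉ l → k + l.sum = d → ‖defect μ k l m‖ ≤ x ^ q * B := by
    induction q with
    | zero =>
      intro k l hk hl hd
      rw [pow_zero, one_mul]
      exact norm_defect_le hn hk hl hm hd hmd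
    | succ q ihq =>
      intro k l hk hl hd
      obtain ⟨k, rfl⟩ := Nat.exists_eq_add_of_le' hk
      have hrec := defect_rec hinv k l m hm fun j hj hjk => by
        have hs := Multiset.sum_erase hj
        exact ih (j - (k + 1) + (m.erase j).sum) (by omega) (by omega)
          (fun h => hm (Multiset.mem_of_mem_erase h)) hl (by omega) rfl
      have h1 : ‖(n : ℂ) * defect μ (k + 1) l m‖ ≤ ((d - 1 : ℕ) : ℝ) * (x ^ q * B) := by
        rw [hrec, norm_neg]
        refine (norm_add_le _ _).trans ?_
        have e1 : ‖∑ r ∈ Finset.range k, defect μ (r + 1) ((k - r) ::ₘ l) m‖ ≤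
            k * (x ^ q * B) := by
          refine (norm_sum_le _ _).trans ((Finset.sum_le_card_nsmul _ _ (x ^ q * B)
            fun r hr => ?_).trans (by simp))
          have := Finset.mem_range.mp hr
          refine ihq _ _ (by omega) ?_ (by rw [Multiset.sum_cons]; omega)
          rw [Multiset.mem_cons, not_or]
          exact ⟨by omega, hl⟩
        have e2 : ‖(l.map fun j : ℕ => (j : ℂ) * defect μ (k + 1 + j) (l.erase j) m).sum‖ ≤
            (l.map fun j : ℕ => (j : ℝ) * (x ^ q * B)).sum := by
          refine norm_multiset_sum_le_card _ _ _ fun j hj => ?_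
          rw [norm_mul, Complex.norm_natCast]
          have := Multiset.sum_erase hj
          exact mul_le_mul_of_nonneg_left (ihq _ _ (by omega)
            (fun h => hl (Multiset.mem_of_mem_erase h)) (by omega)) (by positivity)
        rw [Multiset.sum_map_mul_right, ← Nat.cast_multiset_sum] at e2
        have e3 : ((d - 1 : ℕ) : ℝ) = k + l.sum := by
          rw [← Nat.cast_add]; congr 1; omega
        rw [e3]
        linarith
      rw [norm_mul, Complex.norm_natCast] at h1
      rw [pow_succ, show x ^ q * x * B = ((d - 1 : ℕ) : ℝ) * (x ^ q * B) / n by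
        simp only [x]; ring, le_div_iff₀ hn']
      linarith
  have hx1 : x < 1 := by
    rw [div_lt_one hn']; exact_mod_cast (by omega)
  have hlim : Tendsto (fun q => x ^ q * B) atTop (𝓝 (0 * B)) :=
    (tendsto_pow_atTop_nhds_zero_of_lt_one (by positivity) hx1).mul_const B
  rw [zero_mul] at hlim
  exact norm_le_zero_iff.mp (ge_of_tendsto' hlim fun q => key q k l hk hl hd)

lemma mom_cons {μ : Measure (U n)} [IsProbabilityMeasure μ]
    (hinv : ∀ g : U n, μ.map (fun u => g * u) = μ) {k : ℕ} {l m : Multiset ℕ}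
    (hk : 1 ≤ k) (hl : 0 ∉ l) (hm : 0 ∉ m) (h : k + l.sum ≤ n) :
    mom μ (k ::ₘ l) m =
      (m.map fun j : ℕ => if j = k then (k : ℂ) * mom μ l (m.erase j) else 0).sum :=
  sub_eq_zero.mp (defect_eq_zero hinv hk hl hm h)

/-- The linear combination `∑_{1 ≤ j ≤ N} a_j Tr(u^j)` of power traces. -/
noncomputable def linStat (a : ℕ → ℂ) (N : ℕ) (u : U n) : ℂ :=
  ∑ j ∈ Finset.Icc 1 N, a j * powTr j u

lemma continuous_linStat (a : ℕ → ℂ) (N : ℕ) : Continuous (linStat a N : U n → ℂ) :=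
  continuous_finsetSum _ fun j _ => continuous_const.mul (continuous_powTr j)

lemma ofReal_re_linStat (a : ℕ → ℂ) (N : ℕ) (u : U n) :
    ((linStat a N u).re : ℂ) = ∑ j ∈ Finset.Icc 1 N,
      (a j / 2 * powTr j u + conj (a j) / 2 * conj (powTr j u)) := by
  rw [Complex.re_eq_add_conj, linStat, map_sum, ← Finset.sum_add_distrib, Finset.sum_div]
  refine Finset.sum_congr rfl fun j _ => ?_
  rw [map_mul]; ring

/-- Joint moments of power traces and of the real part of a linear statistic. -/
noncomputable def momLin (μ : Measure (U n)) (a : ℕ → ℂ) (N : ℕ) (l m : Multiset ℕ) (q : ℕ) : ℂ :=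
  ∫ u, prodTr l u * conj (prodTr m u) * ((linStat a N u).re : ℂ) ^ q ∂μ

lemma momLin_zero (μ : Measure (U n)) (a : ℕ → ℂ) (N : ℕ) (l m : Multiset ℕ) :
    momLin μ a N l m 0 = mom μ l m := by simp [momLin, mom]

lemma momLin_conj (μ : Measure (U n)) (a : ℕ → ℂ) (N : ℕ) (l m : Multiset ℕ) (q : ℕ) :
    conj (momLin μ a N l m q) = momLin μ a N m l q := by
  rw [momLin, momLin, ← integral_conj]
  congr 1; funext u
  simp only [map_mul, map_pow, Complex.conj_conj, Complex.conj_ofReal]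
  ring

lemma momLin_succ (μ : Measure (U n)) [IsFiniteMeasure μ] (a : ℕ → ℂ) (N : ℕ)
    (l m : Multiset ℕ) (q : ℕ) :
    momLin μ a N l m (q + 1) = ∑ j ∈ Finset.Icc 1 N,
      (a j / 2 * momLin μ a N (j ::ₘ l) m q + conj (a j) / 2 * momLin μ a N l (j ::ₘ m) q) := by
  have hc (l m : Multiset ℕ) (c : ℂ) : Integrable (fun u : U n =>
      c * (prodTr l u * conj (prodTr m u) * ((linStat a N u).re : ℂ) ^ q)) μ :=
    integrable_of_continuous μ (continuous_const.mul (((continuous_prodTr l).mul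
      (continuous_conj_prodTr m)).mul ((Complex.continuous_ofReal.comp
        (Complex.continuous_re.comp (continuous_linStat a N))).pow q)))
  simp only [momLin, ← integral_const_mul]
  rw [Finset.sum_congr rfl fun j _ => (integral_add (hc _ _ _) (hc _ _ _)).symm,
    ← integral_finsetSum]
  swap
  · exact fun j _ => (hc _ _ _).add (hc _ _ _)
  congr 1; funext u
  rw [pow_succ', ← mul_assoc]
  nth_rw 2 [mul_comm]
  rw [mul_assoc, ofReal_re_linStat a N u, Finset.sum_mul, ← ofReal_re_linStat]
  refine Finset.sum_congr rfl fun j _ => ?_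
  simp only [prodTr_cons, map_mul]
  ring

/-- Gaussian integration by parts with a power of a linear statistic. -/
lemma momLin_cons {μ : Measure (U n)} [IsProbabilityMeasure μ]
    (hinv : ∀ g : U n, μ.map (fun u => g * u) = μ) (a : ℕ → ℂ) {N k : ℕ} {l m : Multiset ℕ}
    {q : ℕ} (hk : 1 ≤ k) (hkN : k ≤ N) (hl : 0 ∉ l) (hm : 0 ∉ m) (h : k + l.sum + q * N ≤ n) :
    momLin μ a N (k ::ₘ l) m q =
      (m.map fun j : ℕ => if j = k then (k : ℂ) * momLin μ a N l (m.erase j) q else 0).sum +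
      q * (k * (conj (a k) / 2) * momLin μ a N l m (q - 1)) := by
  induction q generalizing l m with
  | zero =>
    simp only [momLin_zero, Nat.cast_zero, zero_mul, add_zero]
    exact mom_cons hinv hk hl hm (by omega)
  | succ q ih =>
    have h' : k + l.sum + q * N + N ≤ n := by linarith [Nat.succ_mul q N]
    rw [momLin_succ]
    have e1 (j) (hj : j ∈ Finset.Icc 1 N) : momLin μ a N (j ::ₘ k ::ₘ l) m q =
        (m.map fun i : ℕ => if i = k then
          (k : ℂ) * momLin μ a N (j ::ₘ l) (m.erase i) q else 0).sum +
        q * (k * (conj (a k) / 2) * momLin μ a N (j ::ₘ l) m (q - 1)) := by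
      rw [Finset.mem_Icc] at hj
      rw [Multiset.cons_swap]
      exact ih (l := j ::ₘ l) (by simp only [Multiset.mem_cons, not_or]; exact ⟨by omega, hl⟩) hm
        (by rw [Multiset.sum_cons]; omega)
    have e2 (j) (hj : j ∈ Finset.Icc 1 N) : momLin μ a N (k ::ₘ l) (j ::ₘ m) q =
        (if j = k then (k : ℂ) * momLin μ a N l m q else 0) +
        (m.map fun i : ℕ => if i = k then
          (k : ℂ) * momLin μ a N l (j ::ₘ m.erase i) q else 0).sum +
        q * (k * (conj (a k) / 2) * momLin μ a N l (j ::ₘ m) (q - 1)) := by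
      rw [Finset.mem_Icc] at hj
      rw [ih (m := j ::ₘ m) hl (by simp only [Multiset.mem_cons, not_or]; exact ⟨by omega, hm⟩)
        (by omega), Multiset.map_cons, Multiset.sum_cons, Multiset.erase_cons_head]
      congr 3
      refine Multiset.map_congr rfl fun i hi => ?_
      rw [← Multiset.erase_cons_tail_of_mem hi]
    rw [Finset.sum_congr rfl fun j hj => by rw [e1 j hj, e2 j hj]]
    have e3 : (m.map fun j : ℕ => if j = k then
          (k : ℂ) * momLin μ a N l (m.erase j) (q + 1) else 0).sum =
        ∑ j ∈ Finset.Icc 1 N, (a j / 2 * (m.map fun i : ℕ => if i = k then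
          (k : ℂ) * momLin μ a N (j ::ₘ l) (m.erase i) q else 0).sum +
          conj (a j) / 2 * (m.map fun i : ℕ => if i = k then
          (k : ℂ) * momLin μ a N l (j ::ₘ m.erase i) q else 0).sum) := by
      simp only [← Multiset.sum_map_mul_left, ← Multiset.sum_map_add]
      rw [Finset.sum_eq_multiset_sum, Multiset.sum_map_sum_map]
      refine congrArg _ (Multiset.map_congr rfl fun i _ => ?_)
      change _ = ∑ j ∈ Finset.Icc 1 N, _
      split_ifs
      · rw [momLin_succ, Finset.mul_sum]
        exact Finset.sum_congr rfl fun j _ => by ring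
      · simp
    have e4 : (q : ℂ) * momLin μ a N l m q = ∑ j ∈ Finset.Icc 1 N,
        (q : ℂ) * (a j / 2 * momLin μ a N (j ::ₘ l) m (q - 1) +
          conj (a j) / 2 * momLin μ a N l (j ::ₘ m) (q - 1)) := by
      cases q with
      | zero => simp
      | succ q => rw [momLin_succ, Finset.mul_sum, Nat.add_sub_cancel]
    have e5 : ∑ j ∈ Finset.Icc 1 N, conj (a j) / 2 *
        (if j = k then (k : ℂ) * momLin μ a N l m q else 0) =
        conj (a k) / 2 * (k * momLin μ a N l m q) := by
      rw [Finset.sum_eq_single k]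
      · simp
      · intro j _ hj; simp [hj]
      · intro h; exact absurd (Finset.mem_Icc.mpr ⟨hk, hkN⟩) h
    have e6 : ((q + 1 : ℕ) : ℂ) * (k * (conj (a k) / 2) * momLin μ a N l m (q + 1 - 1)) =
        k * (conj (a k) / 2) * ((q : ℂ) * momLin μ a N l m q) +
        conj (a k) / 2 * (k * momLin μ a N l m q) := by
      rw [Nat.add_sub_cancel]; push_cast; ring
    rw [e6, e3, e4, ← e5, Finset.mul_sum, ← Finset.sum_add_distrib, ← Finset.sum_add_distrib]
    refine Finset.sum_congr rfl fun j _ => ?_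
    ring

/-- The moments of linear statistics satisfy the Gaussian recursion. -/
lemma moment_linStat_add_two {μ : Measure (U n)} [IsProbabilityMeasure μ]
    (hinv : ∀ g : U n, μ.map (fun u => g * u) = μ) (a : ℕ → ℂ) {N q : ℕ} (h : (q + 2) * N ≤ n) :
    ∫ u, (linStat a N u).re ^ (q + 2) ∂μ =
      (q + 1) * ((∑ j ∈ Finset.Icc 1 N, j * ‖a j‖ ^ 2) / 2) * ∫ u, (linStat a N u).re ^ q ∂μ := by
  have h0 (r : ℕ) : ((∫ u, (linStat a N u).re ^ r ∂μ : ℝ) : ℂ) = momLin μ a N 0 0 r := by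
    rw [momLin, ← integral_complex_ofReal]
    simp [prodTr_zero]
  apply Complex.ofReal_injective
  push_cast
  rw [h0, h0, momLin_succ]
  have e1 (j) (hj : j ∈ Finset.Icc 1 N) : momLin μ a N (j ::ₘ 0) 0 (q + 1) =
      (q + 1 : ℕ) * (j * (conj (a j) / 2) * momLin μ a N 0 0 q) := by
    rw [Finset.mem_Icc] at hj
    rw [momLin_cons hinv a hj.1 hj.2 (by simp) (by simp)
      (by rw [Multiset.sum_zero]; linarith [Nat.succ_mul (q + 1) N])]
    simp
  have e2 (j) (hj : j ∈ Finset.Icc 1 N) : momLin μ a N 0 (j ::ₘ 0) (q + 1) =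
      (q + 1 : ℕ) * (j * (a j / 2) * momLin μ a N 0 0 q) := by
    rw [← momLin_conj, e1 j hj]
    simp only [map_mul, map_div₀, map_natCast, Complex.conj_conj, momLin_conj, map_ofNat]
  rw [Finset.sum_congr rfl fun j hj => by rw [e1 j hj, e2 j hj], Finset.sum_div, Finset.mul_sum,
    Finset.sum_mul]
  refine Finset.sum_congr rfl fun j _ => ?_
  rw [← Complex.mul_conj' (a j)]
  push_cast
  ring

lemma moment_linStat_one {μ : Measure (U n)} [IsProbabilityMeasure μ]
    (hinv : ∀ g : U n, μ.map (fun u => g * u) = μ) (a : ℕ → ℂ) (N : ℕ) :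
    ∫ u, (linStat a N u).re ∂μ = 0 := by
  apply Complex.ofReal_injective
  have h0 : ((∫ u, (linStat a N u).re ∂μ : ℝ) : ℂ) = momLin μ a N 0 0 1 := by
    rw [momLin, ← integral_complex_ofReal]
    simp [prodTr_zero]
  rw [h0, momLin_succ, Complex.ofReal_zero]
  refine Finset.sum_eq_zero fun j hj => ?_
  have := (Finset.mem_Icc.mp hj).1
  rw [momLin_zero, momLin_zero, mom_eq_zero hinv (by simp; omega), mom_eq_zero hinv (by simp; omega)]
  simp

lemma integral_norm_powTr_sq {μ : Measure (U n)} [IsProbabilityMeasure μ]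
    (hinv : ∀ g : U n, μ.map (fun u => g * u) = μ) {j : ℕ} (h1 : 1 ≤ j) (hj : j ≤ n) :
    ∫ u, ‖powTr j u‖ ^ 2 ∂μ = j := by
  apply Complex.ofReal_injective
  have h0 : ((∫ u, ‖powTr j u‖ ^ 2 ∂μ : ℝ) : ℂ) = mom μ (j ::ₘ 0) (j ::ₘ 0) := by
    rw [mom, ← integral_complex_ofReal]
    simp only [prodTr_cons, prodTr_zero, mul_one, Complex.mul_conj']
    push_cast; rfl
  rw [h0, mom_cons hinv h1 (by simp) (by simp; omega) (by simpa using hj)]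
  simp [mom, prodTr_zero]

/-- Taylor estimate for the exponential on the left half-plane. -/
lemma norm_exp_sub_sum_le_of_re_nonpos {z : ℂ} (hz : z.re ≤ 0) (Q : ℕ) :
    ‖Complex.exp z - ∑ q ∈ Finset.range Q, z ^ q / q.factorial‖ ≤ ‖z‖ ^ Q / Q.factorial := by
  have key : ∀ t : ℝ, 0 ≤ t → ‖Complex.exp (z * t) - ∑ q ∈ Finset.range Q,
      (z * t) ^ q / q.factorial‖ ≤ (‖z‖ * t) ^ Q / Q.factorial := by
    induction Q with
    | zero =>
      intro t ht
      simp only [Finset.range_zero, Finset.sum_empty, sub_zero, pow_zero, Nat.factorial_zero,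
        Nat.cast_one, div_one, Complex.norm_exp]
      rw [Real.exp_le_one_iff]
      simpa using mul_nonpos_of_nonpos_of_nonneg hz ht
    | succ Q ih =>
      intro t ht
      have hd (x : ℝ) : HasDerivAt (fun x : ℝ => Complex.exp (z * x) -
          ∑ q ∈ Finset.range (Q + 1), (z * x) ^ q / q.factorial)
          (z * (Complex.exp (z * x) - ∑ q ∈ Finset.range Q, (z * x) ^ q / q.factorial)) x := by
        have h1 : HasDerivAt (fun x : ℝ => z * (x : ℂ)) z x := by
          simpa using (Complex.ofRealCLM.hasDerivAt (x := x)).const_mul z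
        have h2 (q : ℕ) := (h1.pow q).div_const (q.factorial : ℂ)
        have h3 := h1.cexp.sub (HasDerivAt.fun_sum (u := Finset.range (Q + 1)) fun q _ => h2 q)
        refine h3.congr_deriv ?_
        rw [mul_sub, mul_comm (Complex.exp _), Finset.sum_range_succ', Finset.mul_sum]
        congr 1
        simp only [Nat.cast_zero, zero_mul, zero_div, add_zero]
        refine Finset.sum_congr rfl fun q _ => ?_
        rw [Nat.add_sub_cancel, Nat.factorial_succ]
        have := Nat.cast_ne_zero (R := ℂ).mpr q.factorial_ne_zero
        have : ((q : ℂ) + 1) ≠ 0 := by exact_mod_cast q.succ_ne_zero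
        push_cast
        field_simp
      have hB (x : ℝ) : HasDerivAt (fun x : ℝ => (‖z‖ * x) ^ (Q + 1) / (Q + 1).factorial)
          (‖z‖ * ((‖z‖ * x) ^ Q / Q.factorial)) x := by
        have h1 : HasDerivAt (fun x : ℝ => ‖z‖ * x) ‖z‖ x := by
          simpa using (hasDerivAt_id x).const_mul ‖z‖
        refine ((h1.pow (Q + 1)).div_const _).congr_deriv ?_
        rw [Nat.add_sub_cancel, Nat.factorial_succ]
        have := Nat.cast_ne_zero (R := ℝ).mpr Q.factorial_ne_zero
        push_cast
        field_simp
      refine image_norm_le_of_norm_deriv_right_le_deriv_boundary (a := 0) (b := t)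
        (fun x _ => (hd x).continuousAt.continuousWithinAt) (fun x _ => (hd x).hasDerivWithinAt)
        ?_ hB ?_ ⟨ht, le_rfl⟩
      · simp [Finset.sum_range_succ']
      · intro x hx
        rw [norm_mul]
        exact mul_le_mul_of_nonneg_left (ih x hx.1) (norm_nonneg _)
  simpa using key 1 zero_le_one

lemma moment_linStat_even {μ : Measure (U n)} [IsProbabilityMeasure μ]
    (hinv : ∀ g : U n, μ.map (fun u => g * u) = μ) (a : ℕ → ℂ) {N p : ℕ} (h : 2 * p * N ≤ n) :
    (∫ u, (linStat a N u).re ^ (2 * p) ∂μ) / (2 * p).factorial =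
      ((∑ j ∈ Finset.Icc 1 N, j * ‖a j‖ ^ 2) / 4) ^ p / p.factorial := by
  induction p with
  | zero => simp
  | succ p ih =>
    have h' : 2 * p * N ≤ n := le_trans (Nat.mul_le_mul_right _ (by omega)) h
    rw [pow_succ, Nat.factorial_succ p, mul_add, mul_one,
      moment_linStat_add_two hinv a (by rwa [mul_add, mul_one] at h),
      Nat.factorial_succ, Nat.factorial_succ]
    have h1 := Nat.cast_ne_zero (R := ℝ).mpr p.factorial_ne_zero
    have h2 := Nat.cast_ne_zero (R := ℝ).mpr (2 * p).factorial_ne_zero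
    specialize ih h'
    rw [div_eq_iff h2] at ih
    rw [ih]
    push_cast
    have h3 : (2 * p + 1 + 1 : ℝ) ≠ 0 := by positivity
    have h4 : (2 * p + 1 : ℝ) ≠ 0 := by positivity
    have h5 : (p + 1 : ℝ) ≠ 0 := by positivity
    field_simp
    ring

lemma moment_linStat_odd {μ : Measure (U n)} [IsProbabilityMeasure μ]
    (hinv : ∀ g : U n, μ.map (fun u => g * u) = μ) (a : ℕ → ℂ) {N p : ℕ}
    (h : (2 * p + 1) * N ≤ n) : ∫ u, (linStat a N u).re ^ (2 * p + 1) ∂μ = 0 := by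
  induction p with
  | zero => simpa using moment_linStat_one hinv a N
  | succ p ih =>
    have h' : (2 * p + 1) * N ≤ n := le_trans (Nat.mul_le_mul_right _ (by omega)) h
    rw [show 2 * (p + 1) + 1 = 2 * p + 1 + 2 by ring,
      moment_linStat_add_two hinv a (by convert h using 2; ring), ih h', mul_zero]

lemma sum_range_two_mul {M : Type*} [AddCommMonoid M] (f : ℕ → M) (Q : ℕ) :
    ∑ q ∈ Finset.range (2 * Q), f q = ∑ p ∈ Finset.range Q, (f (2 * p) + f (2 * p + 1)) := by
  induction Q with
  | zero => simp
  | succ Q ih =>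
    rw [Finset.sum_range_succ, ← ih, show 2 * (Q + 1) = 2 * Q + 1 + 1 by ring,
      Finset.sum_range_succ, Finset.sum_range_succ, add_assoc]

/-- Characteristic functions of linear statistics are nearly Gaussian. -/
lemma norm_charFun_linStat_sub_le {μ : Measure (U n)} [IsProbabilityMeasure μ]
    (hinv : ∀ g : U n, μ.map (fun u => g * u) = μ) (a : ℕ → ℂ) {N Q : ℕ} (h : 2 * Q * N ≤ n)
    {s : ℝ} (hs : s = (∑ j ∈ Finset.Icc 1 N, j * ‖a j‖ ^ 2) / 4) :
    ‖(∫ u, Complex.exp (Complex.I * (linStat a N u).re) ∂μ) - Complex.exp (-s)‖ ≤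
      2 * (s ^ Q / Q.factorial) := by
  have hs0 : 0 ≤ s := by
    rw [hs]; exact div_nonneg (Finset.sum_nonneg fun j _ => by positivity) (by norm_num)
  have hX : Continuous fun u : U n => (linStat a N u).re :=
    Complex.continuous_re.comp (continuous_linStat a N)
  have hXc : Continuous fun u : U n => ((linStat a N u).re : ℂ) :=
    Complex.continuous_ofReal.comp hX
  have hterm (q : ℕ) : Continuous fun u : U n =>
      (Complex.I * ((linStat a N u).re : ℂ)) ^ q / q.factorial :=
    ((continuous_const.mul hXc).pow q).div_const _
  have hexp : Continuous fun u : U n => Complex.exp (Complex.I * (linStat a N u).re) :=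
    (continuous_const.mul hXc).cexp
  have hterm' (q : ℕ) : ∫ u, (Complex.I * ((linStat a N u).re : ℂ)) ^ q / q.factorial ∂μ =
      Complex.I ^ q * (((∫ u, (linStat a N u).re ^ q ∂μ) / q.factorial : ℝ) : ℂ) := by
    push_cast
    rw [← integral_complex_ofReal, ← integral_div, ← integral_const_mul]
    congr 1; funext u; push_cast; ring
  have hsum : ∫ u, ∑ q ∈ Finset.range (2 * Q),
      (Complex.I * ((linStat a N u).re : ℂ)) ^ q / q.factorial ∂μ =
      ∑ p ∈ Finset.range Q, (-(s : ℂ)) ^ p / p.factorial := by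
    rw [integral_finsetSum _ fun q _ => integrable_of_continuous μ (hterm q), sum_range_two_mul]
    refine Finset.sum_congr rfl fun p hp => ?_
    have hp' := Finset.mem_range.mp hp
    rw [hterm', hterm', moment_linStat_odd hinv a
      (le_trans (Nat.mul_le_mul_right _ (by omega)) h), moment_linStat_even hinv a
      (le_trans (Nat.mul_le_mul_right _ (by omega)) h), ← hs, pow_mul, Complex.I_sq, neg_pow (s : ℂ)]
    push_cast
    simp [mul_div_assoc]
  have h1 : ‖(∫ u, Complex.exp (Complex.I * (linStat a N u).re) ∂μ) -
      ∑ p ∈ Finset.range Q, (-(s : ℂ)) ^ p / p.factorial‖ ≤ s ^ Q / Q.factorial := by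
    rw [← hsum, ← integral_sub (integrable_of_continuous μ hexp)
      (integrable_of_continuous μ (continuous_finsetSum _ fun q _ => hterm q)), hs,
      ← moment_linStat_even hinv a h, ← integral_div]
    refine norm_integral_le_of_norm_le (integrable_of_continuous μ ((hX.pow _).div_const _))
      (.of_forall fun u => ?_)
    refine (norm_exp_sub_sum_le_of_re_nonpos (by simp) (2 * Q)).trans_eq ?_
    rw [norm_mul, Complex.norm_I, one_mul, Complex.norm_real, Real.norm_eq_abs,
      Even.pow_abs (even_two_mul Q)]
  have h2 := norm_exp_sub_sum_le_of_re_nonpos (z := -(s : ℂ)) (by simpa using hs0) Q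
  rw [norm_neg, Complex.norm_real, Real.norm_of_nonneg hs0] at h2
  rw [norm_sub_rev] at h2
  exact (norm_sub_le_norm_sub_add_norm_sub _ _ _).trans ((add_le_add h1 h2).trans_eq (by ring))

/-- The representation `A ⊗ conj A`. -/
noncomputable def conjKron (A : Matrix (Fin n) (Fin n) ℂ) :
    Matrix (Fin n × Fin n) (Fin n × Fin n) ℂ :=
  Matrix.kronecker A (A.map (starRingEnd ℂ))

lemma conjKron_mul (A B : Matrix (Fin n) (Fin n) ℂ) :
    conjKron (A * B) = conjKron A * conjKron B := by
  rw [conjKron, conjKron, conjKron, Matrix.map_mul]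
  exact Matrix.mul_kronecker_mul ..

lemma conjKron_one : conjKron (1 : Matrix (Fin n) (Fin n) ℂ) = 1 := by
  rw [conjKron, Matrix.map_one _ (map_zero _) (map_one _)]
  exact Matrix.one_kronecker_one

lemma conjKron_conjTranspose (A : Matrix (Fin n) (Fin n) ℂ) :
    conjKron A.conjTranspose = (conjKron A).conjTranspose := by
  ext i j
  simp [conjKron, Matrix.kronecker]

lemma trace_conjKron (A : Matrix (Fin n) (Fin n) ℂ) :
    (conjKron A).trace = ((‖A.trace‖ ^ 2 : ℝ) : ℂ) := by
  have h : (A.map (starRingEnd ℂ)).trace = conj A.trace := by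
    simp [Matrix.trace, map_sum]
  refine (Matrix.trace_kronecker ..).trans ?_
  rw [h, Complex.mul_conj']
  push_cast; rfl

open scoped ComplexOrder in
/-- Power traces at high frequency are controlled on average by those at low frequency. -/
lemma sum_norm_powTr_sq_le (u : U n) (M m : ℕ) :
    ∑ r ∈ Finset.range m, ∑ s ∈ Finset.range m, ‖powTr (M + r + s) u‖ ^ 2 ≤
      ∑ r ∈ Finset.range m, ∑ s ∈ Finset.range m, ‖diffTr r s u‖ ^ 2 := by
  set V : ℕ → Matrix (Fin n × Fin n) (Fin n × Fin n) ℂ := fun r => conjKron (u.1 ^ r)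
  set W := ∑ r ∈ Finset.range m, V r
  have hV (i j : ℕ) : V i * V j = V (i + j) := by
    simp only [V, ← conjKron_mul, pow_add]
  have hVu : (V M).conjTranspose * V M = 1 := by
    simp only [V]
    rw [← conjKron_conjTranspose, ← conjKron_mul, ← Matrix.star_eq_conjTranspose,
      show star (u.1 ^ M) * u.1 ^ M = 1 from Unitary.star_mul_self_of_mem (u ^ M).2, conjKron_one]
  have h1 : (W * V M * W).trace = ((∑ r ∈ Finset.range m, ∑ s ∈ Finset.range m,
      ‖powTr (M + r + s) u‖ ^ 2 : ℝ) : ℂ) := by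
    simp only [W, Finset.sum_mul, Finset.mul_sum, hV, Matrix.trace_sum]
    push_cast
    rw [Finset.sum_comm]
    refine Finset.sum_congr rfl fun r _ => Finset.sum_congr rfl fun s _ => ?_
    simp only [V]
    rw [trace_conjKron, powTr]
    push_cast
    rw [add_comm r M]
  have h2 : (W * W.conjTranspose).trace = ((∑ r ∈ Finset.range m, ∑ s ∈ Finset.range m,
      ‖diffTr r s u‖ ^ 2 : ℝ) : ℂ) := by
    simp only [W, Finset.sum_mul, Finset.mul_sum, Matrix.conjTranspose_sum, Matrix.trace_sum]
    push_cast
    rw [Finset.sum_comm]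
    refine Finset.sum_congr rfl fun r _ => Finset.sum_congr rfl fun s _ => ?_
    simp only [V]
    rw [← conjKron_conjTranspose, ← conjKron_mul, trace_conjKron, Matrix.conjTranspose_pow,
      ← Matrix.star_eq_conjTranspose, trace_pow_mul_star_pow]
    push_cast; rfl
  have h3 := (Matrix.posSemidef_conjTranspose_mul_self
    (W.conjTranspose - V M * W)).trace_nonneg
  have h4 : (W.conjTranspose - V M * W).conjTranspose * (W.conjTranspose - V M * W) =
      W * W.conjTranspose - W * V M * W - (W * V M * W).conjTranspose +
        W.conjTranspose * ((V M).conjTranspose * V M) * W := by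
    simp only [Matrix.conjTranspose_sub, Matrix.conjTranspose_mul, Matrix.conjTranspose_conjTranspose,
      sub_mul, mul_sub, mul_assoc]
    abel
  rw [h4, hVu, mul_one, Matrix.trace_add, Matrix.trace_sub, Matrix.trace_sub,
    Matrix.trace_conjTranspose, Matrix.trace_mul_comm W.conjTranspose, h1, h2] at h3
  have h5 := (Complex.le_def.mp h3).1
  simp only [Complex.zero_re, Complex.add_re, Complex.sub_re, Complex.ofReal_re,
    Complex.star_def, Complex.conj_re] at h5
  linarith

/-- The second moment of a power trace. -/
noncomputable def secondMoment (μ : Measure (U n)) (j : ℕ) : ℝ := ∫ u, ‖powTr j u‖ ^ 2 ∂μ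

lemma secondMoment_nonneg (μ : Measure (U n)) (j : ℕ) : 0 ≤ secondMoment μ j :=
  integral_nonneg fun u => by positivity

lemma continuous_norm_powTr_sq (j : ℕ) : Continuous fun u : U n => ‖powTr j u‖ ^ 2 :=
  (continuous_powTr j).norm.pow 2

lemma sum_secondMoment_window_le {μ : Measure (U n)} [IsProbabilityMeasure μ]
    (hinv : ∀ g : U n, μ.map (fun u => g * u) = μ) (M : ℕ) {m : ℕ} (hm : m ≤ n) :
    ∑ r ∈ Finset.range m, ∑ s ∈ Finset.range m, secondMoment μ (M + r + s) ≤
      (m : ℝ) * n ^ 2 + m ^ 3 := by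
  have hc (r s : ℕ) : Continuous fun u : U n => ‖diffTr r s u‖ ^ 2 :=
    (continuous_diffTr r s).norm.pow 2
  have h1 : ∑ r ∈ Finset.range m, ∑ s ∈ Finset.range m, secondMoment μ (M + r + s) ≤
      ∑ r ∈ Finset.range m, ∑ s ∈ Finset.range m, ∫ u, ‖diffTr r s u‖ ^ 2 ∂μ := by
    simp only [secondMoment]
    rw [Finset.sum_congr rfl fun r _ => (integral_finsetSum _ fun s _ =>
        integrable_of_continuous μ (continuous_norm_powTr_sq (M + r + s))).symm,
      ← integral_finsetSum _ fun r _ => integrable_of_continuous μ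
        (continuous_finsetSum _ fun s _ => continuous_norm_powTr_sq (M + r + s)),
      Finset.sum_congr rfl fun r _ => (integral_finsetSum _ fun s _ =>
        integrable_of_continuous μ (hc r s)).symm,
      ← integral_finsetSum _ fun r _ => integrable_of_continuous μ
        (continuous_finsetSum _ fun s _ => hc r s)]
    exact integral_mono (integrable_of_continuous μ (continuous_finsetSum _ fun r _ =>
        continuous_finsetSum _ fun s _ => continuous_norm_powTr_sq (M + r + s)))
      (integrable_of_continuous μ (continuous_finsetSum _ fun r _ =>
        continuous_finsetSum _ fun s _ => hc r s)) fun u => sum_norm_powTr_sq_le u M m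
  have h2 (r) (hr : r ∈ Finset.range m) (s) (hs : s ∈ Finset.range m) :
      ∫ u, ‖diffTr r s u‖ ^ 2 ∂μ ≤ (if s = r then (n : ℝ) ^ 2 else 0) + m := by
    have hr := Finset.mem_range.mp hr
    have hs := Finset.mem_range.mp hs
    rcases lt_trichotomy s r with h | h | h
    · simp only [diffTr, if_pos h.le, if_neg h.ne]
      rw [integral_norm_powTr_sq hinv (by omega) (by omega), zero_add]
      exact_mod_cast (by omega)
    · simp [diffTr, h, powTr_zero]
    · simp only [diffTr, if_neg h.not_ge, if_neg h.ne', RCLike.norm_conj]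
      rw [integral_norm_powTr_sq hinv (by omega) (by omega), zero_add]
      exact_mod_cast (by omega)
  refine h1.trans ((Finset.sum_le_sum fun r hr => Finset.sum_le_sum fun s hs =>
    h2 r hr s hs).trans_eq ?_)
  rw [Finset.sum_congr rfl fun r hr => by
    rw [Finset.sum_add_distrib, Finset.sum_ite_eq' (Finset.range m) r, if_pos hr]]
  simp
  ring

lemma sum_inv_sq_le (hn : 1 ≤ n) (K : ℕ) :
    ∑ M ∈ Finset.range K, 1 / ((M : ℝ) + n) ^ 2 ≤ 2 / (n : ℝ) := by
  have hn' : (1 : ℝ) ≤ n := by exact_mod_cast hn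
  have : ∑ M ∈ Finset.range K, 1 / ((M : ℝ) + n) ^ 2 ≤ 2 / (n : ℝ) - 2 / (K + n) := by
    induction K with
    | zero => simp
    | succ K ih =>
      rw [Finset.sum_range_succ]
      have hx : (1 : ℝ) ≤ K + n := by linarith [(Nat.cast_nonneg K : (0 : ℝ) ≤ K)]
      have : 1 / ((K : ℝ) + n) ^ 2 ≤ 2 / (K + n) - 2 / ((K + 1 : ℕ) + n) := by
        push_cast
        rw [show (K : ℝ) + 1 + n = (K + n) + 1 by ring]
        set x : ℝ := K + n
        rw [div_sub_div _ _ (by positivity) (by positivity), div_le_div_iff₀ (by positivity)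
          (by positivity)]
        nlinarith [mul_nonneg (by linarith : (0 : ℝ) ≤ x) (by linarith : (0 : ℝ) ≤ x - 1)]
      linarith
  have h2 : (0 : ℝ) ≤ 2 / (K + n) := by positivity
  linarith

/-- A uniform bound on the contribution of frequencies above `n`. -/
lemma sum_secondMoment_div_sq_le {μ : Measure (U n)} [IsProbabilityMeasure μ]
    (hinv : ∀ g : U n, μ.map (fun u => g * u) = μ) (hn : 1 ≤ n) (K : ℕ) :
    ∑ j ∈ Finset.Ico n K, secondMoment μ j / (j : ℝ) ^ 2 ≤ 24 := by
  obtain ⟨m, hm1, hmn, hm2, hm3⟩ : ∃ m : ℕ, 1 ≤ m ∧ m ≤ n ∧ n ≤ 2 * m ∧ 2 * m ≤ n + 2 :=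
    ⟨n / 2 + 1, by omega, by omega, by omega, by omega⟩
  have hn' : (1 : ℝ) ≤ n := by exact_mod_cast hn
  have hmn' : (m : ℝ) ≤ n := by exact_mod_cast hmn
  have hm1' : (1 : ℝ) ≤ m := by exact_mod_cast hm1
  have hm2' : (n : ℝ) ≤ 2 * m := by exact_mod_cast hm2
  have h1 (r) (hr : r ∈ Finset.range m) (s) (hs : s ∈ Finset.range m) :
      ∑ j ∈ Finset.Ico n K, secondMoment μ j / (j : ℝ) ^ 2 ≤
        ∑ M ∈ Finset.range K, 4 * (1 / ((M : ℝ) + n) ^ 2) * secondMoment μ (M + r + s) := by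
    have hr := Finset.mem_range.mp hr
    have hs := Finset.mem_range.mp hs
    set g : ℕ → ℝ := fun M => 4 * (1 / ((M : ℝ) + n) ^ 2) * secondMoment μ (M + r + s)
    have hg (M : ℕ) : 0 ≤ g M := mul_nonneg (by positivity) (secondMoment_nonneg μ _)
    have e1 : ∑ j ∈ Finset.Ico n K, secondMoment μ j / (j : ℝ) ^ 2 ≤
        ∑ j ∈ Finset.Ico n K, g (j - (r + s)) := by
      refine Finset.sum_le_sum fun j hj => ?_
      have hj := Finset.mem_Ico.mp hj
      simp only [g]
      rw [show j - (r + s) + r + s = j by omega, div_eq_mul_inv, mul_comm]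
      refine mul_le_mul_of_nonneg_right ?_ (secondMoment_nonneg μ _)
      have hj0 : (0 : ℝ) < j := by exact_mod_cast (by omega)
      have hle : ((j - (r + s) : ℕ) : ℝ) + n ≤ 2 * j := by exact_mod_cast (by omega)
      rw [inv_eq_one_div, mul_one_div, div_le_div_iff₀ (by positivity) (by positivity), one_mul]
      calc _ ≤ (2 * (j : ℝ)) ^ 2 := pow_le_pow_left₀ (by positivity) hle 2
        _ = _ := by ring
    refine e1.trans ?_
    rw [← Finset.sum_image (f := g) (g := fun j => j - (r + s))]
    · refine Finset.sum_le_sum_of_subset_of_nonneg ?_ fun M _ _ => hg M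
      intro x hx
      obtain ⟨j, hj, rfl⟩ := Finset.mem_image.mp hx
      have hj := Finset.mem_Ico.mp hj
      exact Finset.mem_range.mpr (by omega)
    · intro i hi j hj hij
      have hi := Finset.mem_Ico.mp hi
      have hj := Finset.mem_Ico.mp hj
      simp only at hij
      omega
  have h2 := Finset.sum_le_sum fun r hr => Finset.sum_le_sum fun s hs => h1 r hr s hs
  have h3 : ∑ r ∈ Finset.range m, ∑ s ∈ Finset.range m, ∑ M ∈ Finset.range K,
      4 * (1 / ((M : ℝ) + n) ^ 2) * secondMoment μ (M + r + s) ≤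
      4 * (2 / (n : ℝ)) * (m * n ^ 2 + m ^ 3) := by
    rw [Finset.sum_congr rfl fun r _ => Finset.sum_comm, Finset.sum_comm]
    simp only [← Finset.mul_sum]
    refine (Finset.sum_le_sum fun M _ => mul_le_mul_of_nonneg_left
      (sum_secondMoment_window_le hinv M hmn) (by positivity)).trans ?_
    rw [← Finset.sum_mul, ← Finset.mul_sum]
    exact mul_le_mul_of_nonneg_right (mul_le_mul_of_nonneg_left (sum_inv_sq_le hn K)
      (by norm_num)) (by positivity)
  simp only [Finset.sum_const, Finset.card_range, nsmul_eq_mul] at h2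
  replace h2 := h2.trans h3
  have h4 : 4 * (2 / (n : ℝ)) * (m * n ^ 2 + m ^ 3) ≤ (m : ℝ) * (m * 24) := by
    rw [show 4 * (2 / (n : ℝ)) * (m * n ^ 2 + m ^ 3) = 8 * m * (n ^ 2 + m ^ 2) / n by
      field_simp; ring, div_le_iff₀ (by positivity)]
    have h5 : (n : ℝ) ^ 2 + m ^ 2 ≤ 3 * m * n := by nlinarith
    nlinarith
  have h6 := h2.trans h4
  exact le_of_mul_le_mul_left (le_of_mul_le_mul_left h6 (by positivity)) (by positivity)

lemma integral_norm_sum_sq {μ : Measure (U n)} [IsProbabilityMeasure μ]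
    (hinv : ∀ g : U n, μ.map (fun u => g * u) = μ) (a : ℕ → ℂ) (F : Finset ℕ) :
    ∫ u, ‖∑ j ∈ F, a j * powTr j u‖ ^ 2 ∂μ = ∑ j ∈ F, ‖a j‖ ^ 2 * secondMoment μ j := by
  apply Complex.ofReal_injective
  have hc (i j : ℕ) : Continuous fun u : U n =>
      a i * conj (a j) * (powTr i u * conj (powTr j u)) :=
    continuous_const.mul ((continuous_powTr i).mul
      (Complex.continuous_conj.comp (continuous_powTr j)))
  have h1 (u : U n) : ((‖∑ j ∈ F, a j * powTr j u‖ ^ 2 : ℝ) : ℂ) =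
      ∑ i ∈ F, ∑ j ∈ F, a i * conj (a j) * (powTr i u * conj (powTr j u)) := by
    push_cast
    rw [← Complex.mul_conj', map_sum, Finset.sum_mul_sum]
    refine Finset.sum_congr rfl fun i _ => Finset.sum_congr rfl fun j _ => ?_
    rw [map_mul]; ring
  rw [← integral_complex_ofReal]
  simp only [h1]
  rw [integral_finsetSum _ fun i _ => integrable_of_continuous μ
    (continuous_finsetSum _ fun j _ => hc i j)]
  push_cast
  refine Finset.sum_congr rfl fun i hi => ?_
  rw [integral_finsetSum _ fun j _ => integrable_of_continuous μ (hc i j),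
    Finset.sum_eq_single i]
  · rw [integral_const_mul, secondMoment, ← integral_complex_ofReal, Complex.mul_conj']
    simp only [Complex.mul_conj']
    push_cast; rfl
  · intro j _ hj
    have := mom_eq_zero (μ := μ) hinv (l := i ::ₘ 0) (m := j ::ₘ 0) (by simpa using hj.symm)
    simp only [mom, prodTr_cons, prodTr_zero, mul_one] at this
    rw [integral_const_mul, this, mul_zero]
  · intro h; exact absurd hi h

lemma sq_integral_le {μ : Measure (U n)} [IsProbabilityMeasure μ] {f : U n → ℝ}
    (hf : Continuous f) : (∫ u, f u ∂μ) ^ 2 ≤ ∫ u, f u ^ 2 ∂μ := by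
  set c := ∫ u, f u ∂μ with hcdef
  have h0 : 0 ≤ ∫ u, (f u ^ 2 - (2 * c * f u - c ^ 2)) ∂μ := by
    refine integral_nonneg fun u => ?_
    have : f u ^ 2 - (2 * c * f u - c ^ 2) = (f u - c) ^ 2 := by ring
    change 0 ≤ f u ^ 2 - (2 * c * f u - c ^ 2)
    rw [this]; positivity
  have i1 : Integrable (fun u => f u ^ 2) μ := integrable_of_continuous μ (hf.pow 2)
  have i2 : Integrable (fun u => 2 * c * f u) μ :=
    integrable_of_continuous μ (continuous_const.mul hf)
  have i3 : Integrable (fun u => 2 * c * f u - c ^ 2) μ := i2.sub (integrable_const _)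
  rw [integral_sub i1 i3, integral_sub i2 (integrable_const _),
    integral_const_mul, integral_const, probReal_univ, one_smul, ← hcdef] at h0
  linarith

lemma norm_exp_I_mul_sub_le (x y : ℝ) :
    ‖Complex.exp (Complex.I * x) - Complex.exp (Complex.I * y)‖ ≤ |x - y| := by
  have h : Complex.exp (Complex.I * x) - Complex.exp (Complex.I * y) =
      Complex.exp (Complex.I * y) * (Complex.exp (Complex.I * ((x - y : ℝ) : ℂ)) - 1) := by
    rw [mul_sub, ← Complex.exp_add, mul_one]
    congr 2; push_cast; ring
  have h2 := norm_exp_sub_sum_le_of_re_nonpos (z := Complex.I * ((x - y : ℝ) : ℂ)) (by simp) 1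
  rw [Finset.sum_range_one, pow_zero, Nat.factorial_zero, Nat.cast_one, div_one, pow_one,
    Nat.factorial_one, Nat.cast_one, div_one, norm_mul, Complex.norm_I, one_mul,
    Complex.norm_real, Real.norm_eq_abs] at h2
  rw [h, norm_mul, mul_comm Complex.I, Complex.norm_exp_ofReal_mul_I, one_mul, mul_comm]
  rwa [mul_comm Complex.I] at h2

/-- Truncating a linear statistic changes its characteristic function by at most the standard
deviation of the remainder. -/
lemma norm_charFun_linStat_sub_linStat_le {μ : Measure (U n)} [IsProbabilityMeasure μ]
    (hinv : ∀ g : U n, μ.map (fun u => g * u) = μ) (a : ℕ → ℂ) {N M : ℕ} (hNM : N ≤ M) :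
    ‖(∫ u, Complex.exp (Complex.I * (linStat a M u).re) ∂μ) -
      ∫ u, Complex.exp (Complex.I * (linStat a N u).re) ∂μ‖ ≤
      Real.sqrt (∑ j ∈ Finset.Ioc N M, ‖a j‖ ^ 2 * secondMoment μ j) := by
  have hX (N : ℕ) : Continuous fun u : U n => Complex.exp (Complex.I * (linStat a N u).re) :=
    (continuous_const.mul (Complex.continuous_ofReal.comp
      (Complex.continuous_re.comp (continuous_linStat a N)))).cexp
  have hsub (u : U n) : linStat a M u - linStat a N u = ∑ j ∈ Finset.Ioc N M, a j * powTr j u := by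
    rw [sub_eq_iff_eq_add', linStat, linStat]
    have h1 (K : ℕ) : Finset.Icc 1 K = Finset.Ioc 0 K := by
      ext; simp [Nat.succ_le_iff]
    rw [h1, h1, ← Finset.sum_union, Finset.Ioc_union_Ioc_eq_Ioc (Nat.zero_le N) hNM]
    exact Finset.Ioc_disjoint_Ioc_of_le le_rfl
  have hd : Continuous fun u : U n => ‖∑ j ∈ Finset.Ioc N M, a j * powTr j u‖ :=
    (continuous_finsetSum _ fun j _ => continuous_const.mul (continuous_powTr j)).norm
  rw [← integral_sub (integrable_of_continuous μ (hX M)) (integrable_of_continuous μ (hX N)),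
    ← integral_norm_sum_sq hinv]
  refine (norm_integral_le_of_norm_le (integrable_of_continuous μ hd)
    (.of_forall fun u => ?_)).trans (Real.le_sqrt_of_sq_le (sq_integral_le hd))
  refine (norm_exp_I_mul_sub_le _ _).trans ?_
  rw [← hsub, ← Complex.sub_re]
  exact Complex.abs_re_le_norm _

/-- The infinite linear statistic `∑_{j ≥ 1} a_j Tr(u^j)`. -/
noncomputable def linSeries (a : ℕ → ℂ) (u : U n) : ℂ := ∑' j : ℕ, a (j + 1) * powTr (j + 1) u

lemma summable_linSeries {a : ℕ → ℂ} (ha : Summable fun j => ‖a j‖) (u : U n) :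
    Summable fun j : ℕ => a (j + 1) * powTr (j + 1) u := by
  refine Summable.of_norm_bounded (((summable_nat_add_iff 1).mpr ha).mul_right (n : ℝ)) fun j => ?_
  rw [norm_mul]
  exact mul_le_mul_of_nonneg_left (norm_powTr_le _ u) (norm_nonneg _)

lemma linStat_eq_sum_range (a : ℕ → ℂ) (N : ℕ) (u : U n) :
    linStat a N u = ∑ j ∈ Finset.range N, a (j + 1) * powTr (j + 1) u := by
  rw [linStat, Finset.range_eq_Ico, Finset.sum_Ico_add' (fun j => a j * powTr j u) 0 N 1]
  rfl

lemma tendsto_charFun_linStat (μ : Measure (U n)) [IsProbabilityMeasure μ] {a : ℕ → ℂ}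
    (ha : Summable fun j => ‖a j‖) :
    Tendsto (fun M => ∫ u, Complex.exp (Complex.I * (linStat a M u).re) ∂μ) atTop
      (𝓝 (∫ u, Complex.exp (Complex.I * (linSeries a u).re) ∂μ)) := by
  refine tendsto_integral_of_dominated_convergence (fun _ => 1) (fun M => ?_)
    (integrable_const _) (fun M => .of_forall fun u => ?_) (.of_forall fun u => ?_)
  · exact (continuous_const.mul (Complex.continuous_ofReal.comp (Complex.continuous_re.comp
      (continuous_linStat a M)))).cexp.measurable.aestronglyMeasurable
  · rw [mul_comm, Complex.norm_exp_ofReal_mul_I]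
  · have h := (summable_linSeries ha u).hasSum.tendsto_sum_nat
    simp only [← linStat_eq_sum_range] at h
    exact ((Complex.continuous_exp.comp (continuous_const.mul (Complex.continuous_ofReal.comp
      Complex.continuous_re))).tendsto _).comp h

/-- Quantitative Gaussian approximation for characteristic functions of infinite linear
statistics. -/
lemma norm_charFun_linSeries_sub_le {μ : Measure (U n)} [IsProbabilityMeasure μ]
    (hinv : ∀ g : U n, μ.map (fun u => g * u) = μ) (hn : 1 ≤ n) {a : ℕ → ℂ}
    (ha : Summable fun j => ‖a j‖) {N Q : ℕ} (h : 2 * Q * N ≤ n) {A ε : ℝ} (hA : 0 ≤ A)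
    (hε : 0 ≤ ε) (haA : ∀ j : ℕ, 1 ≤ j → ‖a j‖ ^ 2 ≤ A * (Real.exp (-2 * j * ε) / (j : ℝ) ^ 2))
    {s : ℝ} (hs : s = (∑ j ∈ Finset.Icc 1 N, j * ‖a j‖ ^ 2) / 4) :
    ‖(∫ u, Complex.exp (Complex.I * (linSeries a u).re) ∂μ) - Complex.exp (-s)‖ ≤
      Real.sqrt (A * (∑ j ∈ Finset.Ioc N n, Real.exp (-2 * j * ε) / j + 24)) +
        2 * (s ^ Q / Q.factorial) := by
  have h1 (M : ℕ) : ∑ j ∈ Finset.Ioc N M, ‖a j‖ ^ 2 * secondMoment μ j ≤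
      A * (∑ j ∈ Finset.Ioc N n, Real.exp (-2 * j * ε) / j + 24) := by
    have hsub : Finset.Ioc N M ⊆ Finset.Ioc N n ∪ (Finset.Ioc N M ∩ Finset.Ico n (M + 1)) := by
      intro j hj
      simp only [Finset.mem_union, Finset.mem_inter, Finset.mem_Ioc, Finset.mem_Ico] at hj ⊢
      omega
    have hnn (j : ℕ) : 0 ≤ ‖a j‖ ^ 2 * secondMoment μ j :=
      mul_nonneg (by positivity) (secondMoment_nonneg μ j)
    refine (Finset.sum_le_sum_of_subset_of_nonneg hsub fun j _ _ => hnn j).trans ?_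
    refine le_trans ((le_add_of_nonneg_right (Finset.sum_nonneg fun j _ => hnn j)).trans_eq
      (Finset.sum_union_inter)) ?_
    rw [mul_add]
    refine add_le_add ?_ ?_
    · rw [Finset.mul_sum]
      refine Finset.sum_le_sum fun j hj => ?_
      have hj := Finset.mem_Ioc.mp hj
      have hj0 : (0 : ℝ) < j := by exact_mod_cast (by omega)
      rw [secondMoment, integral_norm_powTr_sq hinv (by omega) hj.2]
      refine (mul_le_mul_of_nonneg_right (haA j (by omega)) hj0.le).trans_eq ?_
      field_simp
    · have h2 : ∑ j ∈ Finset.Ioc N M ∩ Finset.Ico n (M + 1), ‖a j‖ ^ 2 * secondMoment μ j ≤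
          ∑ j ∈ Finset.Ico n (M + 1), A * (secondMoment μ j / (j : ℝ) ^ 2) := by
        refine (Finset.sum_le_sum_of_subset_of_nonneg Finset.inter_subset_right
          fun j _ _ => hnn j).trans (Finset.sum_le_sum fun j hj => ?_)
        have hj := Finset.mem_Ico.mp hj
        have hj0 : (0 : ℝ) < j := by exact_mod_cast (by omega)
        have h3 : ‖a j‖ ^ 2 ≤ A * (1 / (j : ℝ) ^ 2) := by
          refine (haA j (by omega)).trans (mul_le_mul_of_nonneg_left ?_ hA)
          refine div_le_div_of_nonneg_right ?_ (by positivity)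
          rw [Real.exp_le_one_iff]
          nlinarith [mul_nonneg hj0.le hε]
        refine (mul_le_mul_of_nonneg_right h3 (secondMoment_nonneg μ j)).trans_eq ?_
        ring
      rw [← Finset.mul_sum] at h2
      exact h2.trans (mul_le_mul_of_nonneg_left (sum_secondMoment_div_sq_le hinv hn _) hA)
  have h2 : ‖(∫ u, Complex.exp (Complex.I * (linSeries a u).re) ∂μ) -
      ∫ u, Complex.exp (Complex.I * (linStat a N u).re) ∂μ‖ ≤
      Real.sqrt (A * (∑ j ∈ Finset.Ioc N n, Real.exp (-2 * j * ε) / j + 24)) := by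
    refine le_of_tendsto ((tendsto_charFun_linStat μ ha).sub_const _).norm ?_
    filter_upwards [eventually_ge_atTop N] with M hM
    exact (norm_charFun_linStat_sub_linStat_le hinv a hM).trans (Real.sqrt_le_sqrt (h1 M))
  exact (norm_sub_le_norm_sub_add_norm_sub _ _ _).trans
    (add_le_add h2 (norm_charFun_linStat_sub_le hinv a h hs))

lemma hasSum_exp_div {ε : ℝ} (hε : 0 < ε) :
    HasSum (fun j : ℕ => Real.exp (-2 * ((j + 1 : ℕ) : ℝ) * ε) / ((j + 1 : ℕ) : ℝ))
      (-Real.log (1 - Real.exp (-2 * ε))) := by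
  have h := Real.hasSum_pow_div_log_of_abs_lt_one (x := Real.exp (-2 * ε))
    (by rw [abs_of_pos (Real.exp_pos _), Real.exp_lt_one_iff]; linarith)
  convert h using 2 with j
  push_cast
  rw [← Real.exp_nat_mul]
  congr 2
  push_cast; ring

lemma le_one_sub_exp {ε : ℝ} (hε : 0 < ε) (hε' : ε ≤ 1 / 2) : ε ≤ 1 - Real.exp (-(2 * ε)) := by
  have h1 : Real.exp (-(2 * ε)) ≤ (1 + 2 * ε)⁻¹ := by
    rw [Real.exp_neg]
    exact inv_anti₀ (by linarith) (by linarith [Real.add_one_le_exp (2 * ε)])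
  have h2 : (1 + 2 * ε)⁻¹ ≤ 1 - ε := by
    rw [inv_le_iff_one_le_mul₀ (by linarith)]
    nlinarith
  linarith

/-- The mass of `e^{-2jε}/j` beyond `j = 1/(εL)`, where `L = -log ε`, is negligible with respect
to `L`. -/
lemma sum_exp_div_le_of_lt {ε L : ℝ} (hε : 0 < ε) (hε' : ε ≤ 1 / 2) (hL : L = -Real.log ε)
    {F : Finset ℕ} (hF : ∀ j ∈ F, ⌊1 / (ε * L)⌋₊ < j) :
    ∑ j ∈ F, Real.exp (-2 * (j : ℝ) * ε) / (j : ℝ) ≤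
      L - Real.exp (-2 / L) * (L - Real.log L) := by
  have hL0 : 0 < L := by
    rw [hL, neg_pos]; exact Real.log_neg hε (by linarith)
  set N := ⌊1 / (ε * L)⌋₊ with hN
  have htot : -Real.log (1 - Real.exp (-2 * ε)) ≤ L := by
    rw [hL, neg_le_neg_iff]
    refine Real.log_le_log hε ?_
    rw [neg_mul]
    exact le_one_sub_exp hε hε'
  have hdisj : Disjoint (Finset.Icc 1 N) F := by
    rw [Finset.disjoint_left]
    intro j hj hj'
    have := hF j hj'
    rw [Finset.mem_Icc] at hj
    omega
  have hpos (j : ℕ) : 0 ≤ Real.exp (-2 * (j : ℝ) * ε) / (j : ℝ) := by positivity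
  have h1 : ∑ j ∈ Finset.Icc 1 N ∪ F, Real.exp (-2 * (j : ℝ) * ε) / (j : ℝ) ≤ L := by
    refine le_trans ?_ htot
    have hs : HasSum (fun j : ℕ => Real.exp (-2 * (j : ℝ) * ε) / (j : ℝ))
        (-Real.log (1 - Real.exp (-2 * ε))) := by
      rw [← hasSum_nat_add_iff' 1]
      simpa using hasSum_exp_div hε
    exact sum_le_hasSum _ (fun j _ => hpos j) hs
  rw [Finset.sum_union hdisj] at h1
  have h2 : Real.exp (-2 / L) * (L - Real.log L) ≤
      ∑ j ∈ Finset.Icc 1 N, Real.exp (-2 * (j : ℝ) * ε) / (j : ℝ) := by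
    have h3 : L - Real.log L ≤ ∑ j ∈ Finset.Icc 1 N, (j : ℝ)⁻¹ := by
      have h4 : L - Real.log L = Real.log (1 / (ε * L)) := by
        rw [one_div, Real.log_inv, Real.log_mul hε.ne' hL0.ne', hL]; ring
      have h5 := log_add_one_le_harmonic N
      rw [harmonic_eq_sum_Icc] at h5
      push_cast at h5
      rw [h4]
      refine le_trans (Real.log_le_log (by positivity) ?_) h5
      exact (Nat.lt_floor_add_one _).le
    refine (mul_le_mul_of_nonneg_left h3 (Real.exp_pos _).le).trans ?_
    rw [Finset.mul_sum]
    refine Finset.sum_le_sum fun j hj => ?_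
    rw [div_eq_mul_inv (Real.exp (-2 * (j : ℝ) * ε))]
    refine mul_le_mul_of_nonneg_right (Real.exp_le_exp.mpr ?_) (by positivity)
    have h6 : (j : ℝ) ≤ 1 / (ε * L) :=
      (Nat.cast_le.mpr (Finset.mem_Icc.mp hj).2).trans (Nat.floor_le (by positivity))
    have h7 : (j : ℝ) * ε ≤ 1 / L := by
      calc (j : ℝ) * ε ≤ 1 / (ε * L) * ε := mul_le_mul_of_nonneg_right h6 hε.le
        _ = 1 / L := by field_simp
    have h8 : -2 / L = -2 * (1 / L) := by ring
    rw [h8]; nlinarith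
  linarith

lemma tendsto_sub_exp_mul_div :
    Tendsto (fun L : ℝ => (L - Real.exp (-2 / L) * (L - Real.log L)) / L) atTop (𝓝 0) := by
  have h1 : Tendsto (fun L : ℝ => 1 - Real.exp (-2 / L) * (1 - Real.log L / L)) atTop
      (𝓝 (1 - Real.exp 0 * (1 - 0))) := by
    refine tendsto_const_nhds.sub (Tendsto.mul ?_ (tendsto_const_nhds.sub ?_))
    · exact (Real.continuous_exp.tendsto _).comp (tendsto_const_nhds.div_atTop tendsto_id)
    · exact Real.isLittleO_log_id_atTop.tendsto_div_nhds_zero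
  simp only [Real.exp_zero, sub_zero, mul_one, sub_self] at h1
  refine h1.congr' ?_
  filter_upwards [eventually_gt_atTop 0] with L hL
  field_simp

/-- Central limit theorem, at the level of characteristic functions, for linear statistics with
coefficients of size `e^{-jε}/j`. -/
lemma tendsto_charFun_linSeries (μ : ∀ n : ℕ, Measure (U n)) (hμ : ∀ n, IsProbabilityMeasure (μ n))
    (hinv : ∀ n, ∀ g : U n, (μ n).map (fun u => g * u) = μ n) {ε : ℕ → ℝ}
    (hε0 : Tendsto ε atTop (𝓝 0)) {d : ℝ} (hd : 0 < d) (hεlb : ∀ n : ℕ, d / n ≤ ε n)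
    {a : ℕ → ℕ → ℂ} {B : ℝ} (hB : 0 ≤ B)
    (hsum : ∀ᶠ n in atTop, Summable fun j => ‖a n j‖)
    (haB : ∀ᶠ n in atTop, ∀ j : ℕ, 1 ≤ j →
      ‖a n j‖ ^ 2 ≤ B / (-Real.log (ε n)) * (Real.exp (-2 * j * ε n) / (j : ℝ) ^ 2))
    {v : ℕ → ℝ} {V : ℝ}
    (hv : ∀ᶠ n in atTop, HasSum (fun j : ℕ => (j : ℝ) * ‖a n j‖ ^ 2) (v n))
    (hV : Tendsto v atTop (𝓝 V)) :
    Tendsto (fun n => ∫ u, Complex.exp (Complex.I * (linSeries (a n) u).re) ∂(μ n)) atTop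
      (𝓝 (Complex.exp ((-(V / 4) : ℝ) : ℂ))) := by
  set L : ℕ → ℝ := fun n => -Real.log (ε n) with hLdef
  set N : ℕ → ℕ := fun n => ⌊1 / (ε n * L n)⌋₊ with hNdef
  set τ : ℕ → ℝ := fun n => L n - Real.exp (-2 / L n) * (L n - Real.log (L n)) with hτ
  set s : ℕ → ℝ := fun n => (∑ j ∈ Finset.Icc 1 (N n), j * ‖a n j‖ ^ 2) / 4 with hs
  have hεpos : ∀ᶠ n in atTop, 0 < ε n := by
    filter_upwards [eventually_ge_atTop 1] with n hn
    have : (0 : ℝ) < n := by exact_mod_cast hn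
    exact (by positivity : 0 < d / n).trans_le (hεlb n)
  have hε2 : ∀ᶠ n in atTop, ε n ≤ 1 / 2 :=
    (hε0.eventually_lt_const (by norm_num : (0 : ℝ) < 1 / 2)).mono fun _ h => h.le
  have hL : Tendsto L atTop atTop := by
    refine tendsto_neg_atBot_atTop.comp (Real.tendsto_log_nhdsGT_zero.comp ?_)
    exact tendsto_nhdsWithin_iff.mpr ⟨hε0, hεpos⟩
  have hL0 : ∀ᶠ n in atTop, 0 < L n := hL.eventually_gt_atTop 0
  have hτL : Tendsto (fun n => τ n / L n) atTop (𝓝 0) := tendsto_sub_exp_mul_div.comp hL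
  have hBτ : Tendsto (fun n => B / L n * (τ n + 24)) atTop (𝓝 0) := by
    have h1 : Tendsto (fun n => B * (τ n / L n) + B * (24 / L n)) atTop (𝓝 (B * 0 + B * 0)) :=
      (hτL.const_mul B).add ((tendsto_const_nhds.div_atTop hL).const_mul B)
    rw [mul_zero, add_zero] at h1
    refine h1.congr fun n => ?_
    ring
  have hsv : Tendsto s atTop (𝓝 (V / 4)) := by
    have h1 : Tendsto (fun n => v n / 4 - s n) atTop (𝓝 0) := by
      have h2 : Tendsto (fun n => B * (τ n / L n) / 4) atTop (𝓝 0) := by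
        simpa using (hτL.const_mul B).div_const 4
      refine squeeze_zero' ?_ ?_ h2
      · filter_upwards [hv] with n hn
        have := sum_le_hasSum (Finset.Icc 1 (N n)) (fun j _ => by positivity) hn
        simp only [hs]; linarith
      · filter_upwards [hv, haB, hεpos, hε2, hL0] with n hn hb he he2 hl
        have h3 : ∑ j ∈ Finset.Icc 1 (N n), (j : ℝ) * ‖a n j‖ ^ 2 =
            ∑ j ∈ Finset.range (N n + 1), (j : ℝ) * ‖a n j‖ ^ 2 := by
          rw [Finset.range_eq_Ico, Finset.sum_eq_sum_Ico_succ_bot (by omega)]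
          simp only [Nat.cast_zero, zero_mul, zero_add]
          rfl
        have h4 := (hasSum_nat_add_iff' (N n + 1)).mpr hn
        have h5 : v n - ∑ j ∈ Finset.range (N n + 1), (j : ℝ) * ‖a n j‖ ^ 2 ≤
            B / L n * τ n := by
          refine hasSum_le_of_sum_le h4 fun F => ?_
          have hb' : ∀ j : ℕ, 1 ≤ j → ‖a n j‖ ^ 2 ≤
            B / L n * (Real.exp (-2 * j * ε n) / (j : ℝ) ^ 2) := hb
          have h6 := sum_exp_div_le_of_lt he he2 (rfl : L n = _)
            (F := F.map (addRightEmbedding (N n + 1))) (by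
              intro j hj
              simp only [Finset.mem_map, addRightEmbedding_apply] at hj
              obtain ⟨i, -, rfl⟩ := hj
              simp only [hNdef]; omega)
          rw [Finset.sum_map] at h6
          refine le_trans ?_ (mul_le_mul_of_nonneg_left h6 (div_nonneg hB hl.le))
          rw [Finset.mul_sum]
          refine Finset.sum_le_sum fun i _ => ?_
          simp only [addRightEmbedding_apply]
          have h7 : (0 : ℝ) < ((i + (N n + 1) : ℕ) : ℝ) := by exact_mod_cast (by omega)
          refine (mul_le_mul_of_nonneg_left (hb' (i + (N n + 1)) (by omega)) h7.le).trans_eq ?_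
          field_simp
        simp only [hs]
        rw [h3]
        have h8 : B * (τ n / L n) = B / L n * τ n := by ring
        rw [h8]; linarith
    have h2 := (hV.div_const 4).sub h1
    simpa using h2
  have hfact : Tendsto (fun Q : ℕ => 2 * ((V / 4) ^ Q / Q.factorial)) atTop (𝓝 0) := by
    simpa using (FloorSemiring.tendsto_pow_div_factorial_atTop (V / 4)).const_mul 2
  rw [Metric.tendsto_nhds]
  intro δ hδ
  obtain ⟨Q, hQ⟩ := (hfact.eventually_lt_const hδ).exists
  have hbound : Tendsto (fun n => Real.sqrt (B / L n * (τ n + 24)) + 2 * (s n ^ Q / Q.factorial) +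
      ‖Complex.exp ((-(s n) : ℝ) : ℂ) - Complex.exp ((-(V / 4) : ℝ) : ℂ)‖) atTop
      (𝓝 (Real.sqrt 0 + 2 * ((V / 4) ^ Q / Q.factorial) + 0)) := by
    refine (((Real.continuous_sqrt.tendsto _).comp hBτ).add
      (((hsv.pow Q).div_const _).const_mul 2)).add ?_
    rw [← tendsto_iff_norm_sub_tendsto_zero]
    exact ((Complex.continuous_exp.comp Complex.continuous_ofReal).tendsto _).comp hsv.neg
  rw [Real.sqrt_zero, zero_add, add_zero] at hbound
  filter_upwards [hbound.eventually_lt_const hQ, hsum, haB, hεpos, hε2, hL0,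
    eventually_ge_atTop 1, hL.eventually_ge_atTop (2 * Q / d)] with n hlt hs1 hb he he2 hl hn hlQ
  refine lt_of_le_of_lt ?_ hlt
  have hn0 : (0 : ℝ) < n := by exact_mod_cast hn
  have hQN : 2 * Q * N n ≤ n := by
    have h1 : (N n : ℝ) ≤ 1 / (ε n * L n) := Nat.floor_le (by positivity)
    have h2 : d ≤ ε n * n := by
      have := hεlb n
      rwa [div_le_iff₀ hn0] at this
    have h3 : 2 * (Q : ℝ) ≤ L n * d := by rwa [div_le_iff₀ hd] at hlQ
    have h4 : 2 * (Q : ℝ) * N n ≤ n := by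
      calc 2 * (Q : ℝ) * N n ≤ L n * (ε n * n) * (1 / (ε n * L n)) := by
            refine mul_le_mul (h3.trans (mul_le_mul_of_nonneg_left h2 hl.le)) h1
              (by positivity) (by positivity)
        _ = n := by field_simp
    exact_mod_cast h4
  have hmain := norm_charFun_linSeries_sub_le (hinv n) hn hs1 hQN (div_nonneg hB hl.le) he.le hb
    (s := s n) rfl
  have hτn : ∑ j ∈ Finset.Ioc (N n) n, Real.exp (-2 * (j : ℝ) * ε n) / (j : ℝ) ≤ τ n :=
    sum_exp_div_le_of_lt he he2 rfl fun j hj => (Finset.mem_Ioc.mp hj).1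
  have hsq : Real.sqrt (B / L n * (∑ j ∈ Finset.Ioc (N n) n, Real.exp (-2 * j * ε n) / j + 24)) ≤
      Real.sqrt (B / L n * (τ n + 24)) :=
    Real.sqrt_le_sqrt (mul_le_mul_of_nonneg_left (by linarith) (div_nonneg hB hl.le))
  rw [dist_eq_norm]
  refine (norm_sub_le_norm_sub_add_norm_sub _ (Complex.exp ((-(s n) : ℝ) : ℂ)) _).trans
    (add_le_add ?_ le_rfl)
  rw [Complex.ofReal_neg]
  exact hmain.trans (add_le_add hsq le_rfl)

lemma mul_le_sin {δ x : ℝ} (hδ : 0 < δ) (hx0 : 0 ≤ x) (hx : x ≤ Real.pi - δ) :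
    min (2 / Real.pi) (2 * δ / Real.pi ^ 2) * x ≤ Real.sin x := by
  have hπ := Real.pi_pos
  rcases le_total x (Real.pi / 2) with h | h
  · exact (mul_le_mul_of_nonneg_right (min_le_left _ _) hx0).trans (Real.mul_le_sin hx0 h)
  · rw [← Real.sin_pi_sub]
    refine le_trans ?_ (Real.mul_le_sin (by linarith) (by linarith))
    refine (mul_le_mul_of_nonneg_right (min_le_right _ _) hx0).trans ?_
    calc 2 * δ / Real.pi ^ 2 * x ≤ 2 * δ / Real.pi ^ 2 * Real.pi := by
          refine mul_le_mul_of_nonneg_left (by linarith) (by positivity)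
      _ = 2 / Real.pi * δ := by field_simp
      _ ≤ 2 / Real.pi * (Real.pi - x) := by
          refine mul_le_mul_of_nonneg_left (by linarith) (by positivity)

lemma norm_one_sub_exp_le {ε θ : ℝ} (hε : 0 < ε) :
    ‖1 - Complex.exp (-(2 * ε) + Complex.I * θ)‖ ≤ 3 * max ε |θ| := by
  have h := norm_exp_sub_sum_le_of_re_nonpos (z := -(2 * ε) + Complex.I * θ)
    (by simp [hε.le]) 1
  rw [Finset.sum_range_one, pow_zero, Nat.factorial_zero, Nat.cast_one, div_one, pow_one,
    Nat.factorial_one, Nat.cast_one, div_one, norm_sub_rev] at h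
  have h2 : ‖-(2 * (ε : ℂ)) + Complex.I * θ‖ ≤ 2 * ε + |θ| := by
    refine (norm_add_le _ _).trans_eq ?_
    rw [norm_neg, norm_mul, norm_mul, Complex.norm_real, Complex.norm_real, Complex.norm_I,
      Real.norm_eq_abs, Real.norm_eq_abs, abs_of_pos hε]
    simp
  linarith [le_max_left ε |θ|, le_max_right ε |θ|]

lemma exists_le_norm_one_sub_exp {δ : ℝ} (hδ : 0 < δ) :
    ∃ κ : ℝ, 0 < κ ∧ ∀ ε θ : ℝ, 0 < ε → ε ≤ 1 / 2 → |θ| ≤ 2 * Real.pi - δ →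
      κ * max ε |θ| ≤ ‖1 - Complex.exp (-(2 * ε) + Complex.I * θ)‖ := by
  have hπ := Real.pi_pos
  set κ' := min (2 / Real.pi) (2 * (δ / 2) / Real.pi ^ 2) with hκ'
  have hκ'0 : 0 < κ' := lt_min (by positivity) (by positivity)
  refine ⟨min 1 (κ' / 2), lt_min one_pos (by positivity), fun ε θ hε hε' hθ => ?_⟩
  set z := Complex.exp (-(2 * ε) + Complex.I * θ) with hz
  have hnz : ‖z‖ = Real.exp (-(2 * ε)) := by
    rw [hz, Complex.norm_exp]; simp
  have h1 : 1 - Real.exp (-(2 * ε)) ≤ ‖1 - z‖ := by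
    have := norm_sub_norm_le (1 : ℂ) z
    rwa [norm_one, hnz] at this
  have h2 : ‖Complex.exp (Complex.I * θ) - 1‖ ≤ 2 * ‖1 - z‖ := by
    have h3 : Complex.exp (Complex.I * θ) - 1 = (Complex.exp (Complex.I * θ) - z) - (1 - z) := by
      ring
    have h4 : Complex.exp (Complex.I * θ) - z =
        Complex.exp (Complex.I * θ) * ((1 - Real.exp (-(2 * ε)) : ℝ) : ℂ) := by
      rw [hz, Complex.exp_add]; push_cast; ring
    have h5 : ‖Complex.exp (Complex.I * θ) - z‖ = 1 - Real.exp (-(2 * ε)) := by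
      rw [h4, norm_mul, mul_comm Complex.I, Complex.norm_exp_ofReal_mul_I, one_mul,
        Complex.norm_real, Real.norm_of_nonneg]
      exact hε.le.trans (le_one_sub_exp hε hε')
    rw [h3]
    refine (norm_sub_le _ _).trans ?_
    rw [h5]; linarith
  rw [Complex.norm_exp_I_mul_ofReal_sub_one, Real.norm_eq_abs, abs_mul, abs_two] at h2
  have h6 : κ' * (|θ| / 2) ≤ |Real.sin (θ / 2)| := by
    have h7 := mul_le_sin (x := |θ| / 2) (half_pos hδ) (by positivity) (by linarith)
    refine h7.trans ?_
    rcases abs_cases θ with ⟨h, -⟩ | ⟨h, -⟩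
    · rw [h]; exact le_abs_self _
    · rw [h, neg_div, Real.sin_neg]; exact neg_le_abs _
  rcases le_total ε |θ| with h | h
  · rw [max_eq_right h]
    calc min 1 (κ' / 2) * |θ| ≤ κ' / 2 * |θ| :=
          mul_le_mul_of_nonneg_right (min_le_right _ _) (abs_nonneg _)
      _ ≤ _ := by linarith
  · rw [max_eq_left h]
    calc min 1 (κ' / 2) * ε ≤ 1 * ε := mul_le_mul_of_nonneg_right (min_le_left _ _) hε.le
      _ ≤ _ := by linarith [le_one_sub_exp hε hε']

lemma tendsto_neg_log_one_sub_exp_div {ε θ : ℕ → ℝ} (hε0 : Tendsto ε atTop (𝓝[>] 0)) {δ : ℝ}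
    (hδ : 0 < δ) (hθ : ∀ n, |θ n| ≤ 2 * Real.pi - δ) {p : ℝ}
    (hp : Tendsto (fun n => Real.log (max (ε n) |θ n|) / Real.log (ε n)) atTop (𝓝 p)) :
    Tendsto (fun n => -Complex.log (1 - Complex.exp (-(2 * ε n) + Complex.I * θ n)) /
      ((-Real.log (ε n) : ℝ) : ℂ)) atTop (𝓝 (p : ℂ)) := by
  obtain ⟨κ, hκ, hlow⟩ := exists_le_norm_one_sub_exp hδ
  obtain ⟨hε1, hεpos⟩ := tendsto_nhdsWithin_iff.mp hε0
  have hL : Tendsto (fun n => -Real.log (ε n)) atTop atTop :=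
    tendsto_neg_atBot_atTop.comp (Real.tendsto_log_nhdsGT_zero.comp hε0)
  have hbd (C : ℝ) : Tendsto (fun n => C / (-Real.log (ε n))) atTop (𝓝 0) :=
    tendsto_const_nhds.div_atTop hL
  have hmain : Tendsto (fun n => -Complex.log (1 - Complex.exp (-(2 * ε n) + Complex.I * θ n)) /
      ((-Real.log (ε n) : ℝ) : ℂ) - ((Real.log (max (ε n) |θ n|) / Real.log (ε n) : ℝ) : ℂ))
      atTop (𝓝 0) := by
    refine squeeze_zero_norm' ?_ (hbd (|Real.log κ| + Real.log 3 + Real.pi))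
    filter_upwards [hεpos, hε1.eventually_lt_const (by norm_num : (0 : ℝ) < 1 / 2),
      hL.eventually_gt_atTop 0] with n he he2 hl
    have he : 0 < ε n := he
    set w := 1 - Complex.exp (-(2 * ε n) + Complex.I * θ n) with hw
    set m := max (ε n) |θ n| with hm
    have hm0 : 0 < m := lt_max_of_lt_left he
    have hlo := hlow (ε n) (θ n) he he2.le (hθ n)
    have hup := norm_one_sub_exp_le (θ := θ n) he
    rw [← hw, ← hm] at hlo hup
    have hw0 : 0 < ‖w‖ := (mul_pos hκ hm0).trans_le hlo
    have hlog1 : Real.log κ + Real.log m ≤ Real.log ‖w‖ := by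
      rw [← Real.log_mul hκ.ne' hm0.ne']
      exact Real.log_le_log (by positivity) hlo
    have hlog2 : Real.log ‖w‖ ≤ Real.log 3 + Real.log m := by
      rw [← Real.log_mul (by norm_num) hm0.ne']
      exact Real.log_le_log hw0 hup
    have h3 : 0 ≤ Real.log 3 := Real.log_nonneg (by norm_num)
    have heq : -Complex.log w / ((-Real.log (ε n) : ℝ) : ℂ) -
        ((Real.log m / Real.log (ε n) : ℝ) : ℂ) =
        -(Complex.log w - (Real.log m : ℂ)) / ((-Real.log (ε n) : ℝ) : ℂ) := by
      have : (Real.log (ε n) : ℂ) ≠ 0 := by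
        have : Real.log (ε n) ≠ 0 := by linarith
        exact_mod_cast this
      push_cast
      field_simp
    rw [heq, norm_div, norm_neg, Complex.norm_real, Real.norm_of_nonneg hl.le]
    refine div_le_div_of_nonneg_right ?_ hl.le
    refine (Complex.norm_le_abs_re_add_abs_im _).trans ?_
    rw [Complex.sub_re, Complex.sub_im, Complex.ofReal_re, Complex.ofReal_im, sub_zero,
      Complex.log_re, Complex.log_im]
    refine add_le_add (abs_le.mpr ⟨?_, ?_⟩) (Complex.abs_arg_le_pi _)
    · linarith [neg_abs_le (Real.log κ)]
    · linarith [abs_nonneg (Real.log κ)]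
  have := hmain.add ((Complex.continuous_ofReal.tendsto _).comp hp)
  simpa using this

/-- The limit of `min (log |θ|) / log ε` truncated at `1`. -/
lemma tendsto_log_max_div {ε θ : ℕ → ℝ} (hε0 : Tendsto ε atTop (𝓝[>] 0)) (hθ : ∀ n, θ n ≠ 0)
    {c : ℝ≥0∞}
    (hc : Tendsto (fun n => ((Real.log |θ n| / Real.log (ε n) : ℝ) : EReal)) atTop (𝓝 c)) :
    Tendsto (fun n => Real.log (max (ε n) |θ n|) / Real.log (ε n)) atTop
      (𝓝 (min c 1).toReal) := by
  have hc1 : min c 1 ≠ ⊤ := (min_le_right c 1).trans_lt ENNReal.one_lt_top |>.ne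
  have h1 : Tendsto (fun n => min ((Real.log |θ n| / Real.log (ε n) : ℝ) : EReal) 1) atTop
      (𝓝 (min (c : EReal) 1)) := hc.min tendsto_const_nhds
  have h2 : min (c : EReal) 1 = (((min c 1).toReal : ℝ) : EReal) := by
    rw [EReal.coe_ennreal_toReal hc1, EReal.coe_ennreal_strictMono.monotone.map_min,
      EReal.coe_ennreal_one]
  rw [h2] at h1
  have h4 (n : ℕ) : min ((Real.log |θ n| / Real.log (ε n) : ℝ) : EReal) 1 =
      ((min (Real.log |θ n| / Real.log (ε n)) 1 : ℝ) : EReal) := by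
    rw [EReal.coe_strictMono.monotone.map_min, EReal.coe_one]
  simp only [h4, EReal.tendsto_coe] at h1
  refine h1.congr' ?_
  obtain ⟨hε1, hεpos⟩ := tendsto_nhdsWithin_iff.mp hε0
  filter_upwards [hεpos, hε1.eventually_lt_const one_pos] with n he he1
  have he : 0 < ε n := he
  have hneg := Real.log_neg he he1
  have ht : 0 < |θ n| := abs_pos.mpr (hθ n)
  rcases le_total (ε n) |θ n| with h | h
  · rw [max_eq_right h, min_eq_left]
    rw [div_le_one_of_neg hneg]
    exact Real.log_le_log he h
  · rw [max_eq_left h, min_eq_right, div_self hneg.ne]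
    rw [one_le_div_of_neg hneg]
    exact Real.log_le_log ht h

/-- The coefficients of `∑ₖ conj (t k) log Z(u, e^{ε + i φ k}) / √(-log ε)` as a linear
statistic. -/
noncomputable def logZCoeff {ℓ : ℕ} (t : Fin ℓ → ℂ) (φ : Fin ℓ → ℝ) (ε : ℝ) (j : ℕ) : ℂ :=
  -((Real.sqrt (-Real.log ε) : ℂ)⁻¹ *
    (∑ k, conj (t k) * Complex.exp (-(j : ℂ) * (ε + φ k * Complex.I))) / j)

lemma summable_exp_neg_pow {ε : ℝ} (hε : 0 < ε) : Summable fun j : ℕ => Real.exp (-ε) ^ j :=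
  summable_geometric_of_lt_one (Real.exp_pos _).le (by rw [Real.exp_lt_one_iff]; linarith)

lemma norm_exp_neg_mul (ε θ : ℝ) (j : ℕ) :
    ‖Complex.exp (-(j : ℂ) * (ε + θ * Complex.I))‖ = Real.exp (-(j : ℝ) * ε) := by
  rw [Complex.norm_exp]; simp

lemma norm_logZCoeff_sq_le {ℓ : ℕ} (t : Fin ℓ → ℂ) (φ : Fin ℓ → ℝ) {ε : ℝ}
    (hL : 0 < -Real.log ε) (j : ℕ) :
    ‖logZCoeff t φ ε j‖ ^ 2 ≤
      (∑ k, ‖t k‖) ^ 2 / (-Real.log ε) * (Real.exp (-2 * j * ε) / (j : ℝ) ^ 2) := by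
  rw [logZCoeff, norm_neg, norm_div, norm_mul, norm_inv, Complex.norm_real, Complex.norm_natCast,
    Real.norm_of_nonneg (Real.sqrt_nonneg _), div_pow, mul_pow, inv_pow, Real.sq_sqrt hL.le]
  have h1 : ‖∑ k, conj (t k) * Complex.exp (-(j : ℂ) * (ε + φ k * Complex.I))‖ ≤
      (∑ k, ‖t k‖) * Real.exp (-(j : ℝ) * ε) := by
    refine (norm_sum_le _ _).trans_eq ?_
    rw [Finset.sum_mul]
    refine Finset.sum_congr rfl fun k _ => ?_
    rw [norm_mul, norm_exp_neg_mul, RCLike.norm_conj]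
  have h2 : Real.exp (-2 * j * ε) = Real.exp (-(j : ℝ) * ε) ^ 2 := by
    rw [← Real.exp_nat_mul]; congr 1; push_cast; ring
  have h3 := pow_le_pow_left₀ (norm_nonneg _) h1 2
  calc (-Real.log ε)⁻¹ * ‖∑ k, conj (t k) * Complex.exp (-(j : ℂ) * (ε + φ k * Complex.I))‖ ^ 2 /
        (j : ℝ) ^ 2 ≤ (-Real.log ε)⁻¹ * ((∑ k, ‖t k‖) * Real.exp (-(j : ℝ) * ε)) ^ 2 / (j : ℝ) ^ 2 :=
        div_le_div_of_nonneg_right (mul_le_mul_of_nonneg_left h3 (by positivity)) (by positivity)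
    _ = _ := by rw [h2, mul_pow]; ring

lemma summable_norm_logZCoeff {ℓ : ℕ} (t : Fin ℓ → ℂ) (φ : Fin ℓ → ℝ) {ε : ℝ} (hε : 0 < ε)
    (hL : 0 < -Real.log ε) : Summable fun j => ‖logZCoeff t φ ε j‖ := by
  refine Summable.of_nonneg_of_le (fun _ => norm_nonneg _) (fun j => ?_)
    ((summable_exp_neg_pow hε).mul_left (Real.sqrt ((∑ k, ‖t k‖) ^ 2 / (-Real.log ε))))
  have h1 := Real.le_sqrt_of_sq_le (norm_logZCoeff_sq_le t φ hL j)
  rw [Real.sqrt_mul (by positivity)] at h1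
  refine h1.trans (mul_le_mul_of_nonneg_left ?_ (Real.sqrt_nonneg _))
  refine (Real.sqrt_le_sqrt (y := (Real.exp (-ε) ^ j) ^ 2) ?_).trans_eq
    (Real.sqrt_sq (by positivity))
  have h2 : Real.exp (-2 * j * ε) = (Real.exp (-ε) ^ j) ^ 2 := by
    rw [← Real.exp_nat_mul, ← Real.exp_nat_mul]; congr 1; push_cast; ring
  rw [h2]
  rcases Nat.eq_zero_or_pos j with rfl | hj
  · simp
  · exact div_le_self (by positivity) (one_le_pow₀ (by exact_mod_cast hj))

lemma norm_logZ_term_le (u : U n) (ε φ : ℝ) (j : ℕ) :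
    ‖Matrix.trace ((u : Matrix (Fin n) (Fin n) ℂ) ^ (j + 1)) *
      Complex.exp (-((j : ℂ) + 1) * (ε + φ * Complex.I)) / ((j : ℂ) + 1)‖ ≤
      n * Real.exp (-ε) ^ (j + 1) := by
  have h1 := norm_powTr_le (j + 1) u
  have h2 := norm_exp_neg_mul ε φ (j + 1)
  push_cast at h2
  have h3 : ‖(j : ℂ) + 1‖ = (j : ℝ) + 1 := by
    have := Complex.norm_natCast (j + 1)
    push_cast at this; exact this
  rw [norm_div, norm_mul, h2, h3]
  have h4 : Real.exp (-((j : ℝ) + 1) * ε) = Real.exp (-ε) ^ (j + 1) := by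
    rw [← Real.exp_nat_mul]; congr 1; push_cast; ring
  rw [h4]
  refine (div_le_self (by positivity) (by linarith [(Nat.cast_nonneg j : (0 : ℝ) ≤ j)])).trans ?_
  exact mul_le_mul_of_nonneg_right h1 (by positivity)

lemma summable_logZ (u : U n) {ε : ℝ} (hε : 0 < ε) (φ : ℝ) :
    Summable fun j : ℕ => Matrix.trace ((u : Matrix (Fin n) (Fin n) ℂ) ^ (j + 1)) *
      Complex.exp (-((j : ℂ) + 1) * (ε + φ * Complex.I)) / ((j : ℂ) + 1) :=
  Summable.of_norm_bounded
    (((summable_nat_add_iff 1).mpr (summable_exp_neg_pow hε)).mul_left (n : ℝ))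
    (norm_logZ_term_le u ε φ)

lemma linSeries_logZCoeff {ℓ : ℕ} (t : Fin ℓ → ℂ) (φ : Fin ℓ → ℝ) {ε : ℝ} (hε : 0 < ε) (u : U n) :
    linSeries (logZCoeff t φ ε) u =
      ∑ k, conj (t k) * ((Real.sqrt (-Real.log ε) : ℂ)⁻¹ * logZ n u ε (φ k)) := by
  have h1 (k : Fin ℓ) := ((summable_logZ u hε (φ k)).hasSum.neg.mul_left
    (Real.sqrt (-Real.log ε) : ℂ)⁻¹).mul_left (conj (t k))
  have h2 := hasSum_sum fun k (_ : k ∈ Finset.univ) => h1 k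
  have h3 : (fun j : ℕ => logZCoeff t φ ε (j + 1) * powTr (j + 1) u) = fun j : ℕ =>
      ∑ k, conj (t k) * ((Real.sqrt (-Real.log ε) : ℂ)⁻¹ *
        -(Matrix.trace ((u : Matrix (Fin n) (Fin n) ℂ) ^ (j + 1)) *
          Complex.exp (-((j : ℂ) + 1) * (ε + φ k * Complex.I)) / ((j : ℂ) + 1))) := by
    funext j
    rw [logZCoeff, neg_mul, mul_div_assoc, mul_assoc, Finset.sum_div, Finset.sum_mul,
      Finset.mul_sum, ← Finset.sum_neg_distrib]
    refine Finset.sum_congr rfl fun k _ => ?_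
    rw [powTr]
    push_cast
    ring
  rw [linSeries, h3]
  exact h2.tsum_eq

lemma hasSum_mul_norm_logZCoeff_sq {ℓ : ℕ} (t : Fin ℓ → ℂ) (φ : Fin ℓ → ℝ) {ε : ℝ} (hε : 0 < ε)
    (hL : 0 < -Real.log ε) :
    HasSum (fun j : ℕ => (j : ℝ) * ‖logZCoeff t φ ε j‖ ^ 2)
      (∑ k, ∑ l, conj (t k) * (-Complex.log (1 - Complex.exp (-(2 * ε) +
        Complex.I * ((φ l - φ k : ℝ) : ℂ))) / ((-Real.log ε : ℝ) : ℂ)) * t l).re := by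
  have hlt (θ : ℝ) : ‖Complex.exp (-(2 * ε) + Complex.I * θ)‖ < 1 := by
    rw [Complex.norm_exp, Real.exp_lt_one_iff]; simp [hε]
  have h1 := hasSum_sum fun k (_ : k ∈ (Finset.univ : Finset (Fin ℓ))) =>
    hasSum_sum fun l (_ : l ∈ (Finset.univ : Finset (Fin ℓ))) =>
    (((Complex.hasSum_taylorSeries_neg_log (hlt (φ l - φ k))).div_const
      ((-Real.log ε : ℝ) : ℂ)).mul_left (conj (t k))).mul_right (t l)
  have h2 := Complex.hasSum_re h1
  convert h2 using 2 with j
  rw [← Complex.ofReal_re ((j : ℝ) * ‖logZCoeff t φ ε j‖ ^ 2)]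
  congr 1
  have hsq : ((Real.sqrt (-Real.log ε) : ℝ) : ℂ) ^ 2 = ((-Real.log ε : ℝ) : ℂ) := by
    rw [← Complex.ofReal_pow, Real.sq_sqrt hL.le]
  have hs0 : ((Real.sqrt (-Real.log ε) : ℝ) : ℂ) ≠ 0 := by
    exact_mod_cast (Real.sqrt_pos.mpr hL).ne'
  rw [Complex.ofReal_mul, Complex.ofReal_pow, Complex.ofReal_natCast, ← Complex.mul_conj',
    logZCoeff]
  simp only [map_neg, map_div₀, map_mul, map_inv₀, map_sum, Complex.conj_conj, Complex.conj_ofReal,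
    map_natCast]
  set s := ((Real.sqrt (-Real.log ε) : ℝ) : ℂ)
  rcases Nat.eq_zero_or_pos j with rfl | hj
  · simp
  have hj0 : (j : ℂ) ≠ 0 := by exact_mod_cast hj.ne'
  have h3 (x y : ℂ) : (j : ℂ) * (-(s⁻¹ * x / j) * -(s⁻¹ * y / j)) = x * y / (j * s ^ 2) := by
    field_simp
  rw [h3, hsq, Finset.sum_mul_sum, Finset.sum_div]
  refine Finset.sum_congr rfl fun k _ => ?_
  rw [Finset.sum_div]
  refine Finset.sum_congr rfl fun l _ => ?_
  have h4 : Complex.exp (-(2 * ε) + Complex.I * ((φ l - φ k : ℝ) : ℂ)) ^ j =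
      Complex.exp (-(j : ℂ) * (ε + φ k * Complex.I)) *
        conj (Complex.exp (-(j : ℂ) * (ε + φ l * Complex.I))) := by
    rw [← Complex.exp_conj, ← Complex.exp_add, ← Complex.exp_nat_mul]
    congr 1
    simp only [map_mul, map_neg, map_natCast, map_add, Complex.conj_ofReal, Complex.conj_I]
    push_cast; ring
  rw [h4]
  ring

section

variable {ℓ : ℕ} {ε : ℕ → ℝ} {φ : Fin ℓ → ℕ → ℝ} {δ₀ : ℝ} {C : Fin ℓ → Fin ℓ → ℝ}

lemma abs_sub_le_two_pi (hφ0 : ∀ n i, 0 ≤ φ i n) (hφub : ∀ n i, φ i n < 2 * Real.pi - δ₀)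
    (k l : Fin ℓ) (n : ℕ) : |φ l n - φ k n| ≤ 2 * Real.pi - δ₀ := by
  rw [abs_le]
  constructor <;> linarith [hφ0 n k, hφ0 n l, hφub n k, hφub n l]

lemma eventually_neg_log_pos (hε0 : Tendsto ε atTop (𝓝[>] 0)) :
    ∀ᶠ n in atTop, 0 < -Real.log (ε n) :=
  (tendsto_neg_atBot_atTop.comp (Real.tendsto_log_nhdsGT_zero.comp hε0)).eventually_gt_atTop 0

/-- The limiting covariance of linear forms in `log Z`. -/
lemma tendsto_variance_logZCoeff (hε0 : Tendsto ε atTop (𝓝[>] 0)) (hδ₀ : 0 < δ₀)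
    (hφ0 : ∀ n i, 0 ≤ φ i n) (hφub : ∀ n i, φ i n < 2 * Real.pi - δ₀)
    (hC : ∀ k l, Tendsto (fun n => Real.log (max (ε n) |φ l n - φ k n|) / Real.log (ε n))
      atTop (𝓝 (C k l))) (t : Fin ℓ → ℂ) :
    Tendsto (fun n => (∑ k, ∑ l, conj (t k) * (-Complex.log (1 - Complex.exp (-(2 * ε n) +
        Complex.I * ((φ l n - φ k n : ℝ) : ℂ))) / ((-Real.log (ε n) : ℝ) : ℂ)) * t l).re) atTop
      (𝓝 (∑ k, ∑ l, conj (t k) * C k l * t l).re) := by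
  refine (Complex.continuous_re.tendsto _).comp ?_
  refine tendsto_finsetSum _ fun k _ => tendsto_finsetSum _ fun l _ => ?_
  exact ((tendsto_neg_log_one_sub_exp_div hε0 hδ₀ (abs_sub_le_two_pi hφ0 hφub k l)
    (hC k l)).const_mul _).mul_const _

lemma quadraticForm_nonneg (hε0 : Tendsto ε atTop (𝓝[>] 0)) (hδ₀ : 0 < δ₀)
    (hφ0 : ∀ n i, 0 ≤ φ i n) (hφub : ∀ n i, φ i n < 2 * Real.pi - δ₀)
    (hC : ∀ k l, Tendsto (fun n => Real.log (max (ε n) |φ l n - φ k n|) / Real.log (ε n))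
      atTop (𝓝 (C k l))) (t : Fin ℓ → ℂ) :
    0 ≤ (∑ k, ∑ l, conj (t k) * C k l * t l).re := by
  refine ge_of_tendsto (tendsto_variance_logZCoeff hε0 hδ₀ hφ0 hφub hC t) ?_
  filter_upwards [(tendsto_nhdsWithin_iff.mp hε0).2, eventually_neg_log_pos hε0] with n he hl
  exact (hasSum_mul_norm_logZCoeff_sq t (fun k => φ k n) he hl).nonneg fun j => by positivity

/-- Convergence of the characteristic functions of linear forms in `log Z`. -/
lemma tendsto_charFun_logZ (μ : ∀ n : ℕ, Measure (U n)) (hμ : ∀ n, IsProbabilityMeasure (μ n))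
    (hinv : ∀ n, ∀ g : U n, (μ n).map (fun u => g * u) = μ n)
    (hε0 : Tendsto ε atTop (𝓝[>] 0)) {d : ℝ} (hd : 0 < d) (hεlb : ∀ n : ℕ, d / n ≤ ε n)
    (hδ₀ : 0 < δ₀) (hφ0 : ∀ n i, 0 ≤ φ i n) (hφub : ∀ n i, φ i n < 2 * Real.pi - δ₀)
    (hC : ∀ k l, Tendsto (fun n => Real.log (max (ε n) |φ l n - φ k n|) / Real.log (ε n))
      atTop (𝓝 (C k l))) (t : Fin ℓ → ℂ) :
    Tendsto (fun n => ∫ u, Complex.exp (Complex.I * ((∑ k, conj (t k) *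
      ((Real.sqrt (-Real.log (ε n)) : ℂ)⁻¹ * logZ n u (ε n) (φ k n))).re : ℝ)) ∂(μ n)) atTop
      (𝓝 (Complex.exp ((-((∑ k, ∑ l, conj (t k) * C k l * t l).re / 4) : ℝ) : ℂ))) := by
  obtain ⟨hε1, hεpos⟩ := tendsto_nhdsWithin_iff.mp hε0
  have hpos := hεpos.and (eventually_neg_log_pos hε0)
  refine (tendsto_charFun_linSeries μ hμ hinv hε1 hd hεlb
    (a := fun n => logZCoeff t (fun k => φ k n) (ε n)) (sq_nonneg (∑ k, ‖t k‖))
    (hpos.mono fun n h => summable_norm_logZCoeff t _ h.1 h.2)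
    (hpos.mono fun n h j _ => norm_logZCoeff_sq_le t _ h.2 j)
    (hpos.mono fun n h => hasSum_mul_norm_logZCoeff_sq t _ h.1 h.2)
    (tendsto_variance_logZCoeff hε0 hδ₀ hφ0 hφub hC t)).congr' ?_
  filter_upwards [hεpos] with n he
  simp only [linSeries_logZCoeff t (fun k => φ k n) he]

end

lemma continuous_logZ {ε : ℝ} (hε : 0 < ε) (φ : ℝ) : Continuous fun u : U n => logZ n u ε φ := by
  refine (continuous_tsum (u := fun j => n * Real.exp (-ε) ^ (j + 1)) (fun j => ?_)
    (((summable_nat_add_iff 1).mpr (summable_exp_neg_pow hε)).mul_left (n : ℝ)) fun j u => norm_logZ_term_le u ε φ j).neg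
  exact ((continuous_powTr (j + 1)).mul continuous_const).div_const _

instance : IsProbabilityMeasure stdComplexNormal :=
  Measure.isProbabilityMeasure_map (by fun_prop)

lemma integral_exp_stdComplexNormal (w : ℂ) :
    ∫ z, Complex.exp (Complex.I * (w * z).re) ∂stdComplexNormal =
      Complex.exp ((-(‖w‖ ^ 2 / 4) : ℝ) : ℂ) := by
  have hc : Continuous fun z : ℂ => Complex.exp (Complex.I * (w * z).re) := by fun_prop
  rw [stdComplexNormal, integral_map (by fun_prop) hc.aestronglyMeasurable]
  have h1 (p : ℝ × ℝ) : Complex.exp (Complex.I * ((w * ((p.1 : ℂ) + p.2 * Complex.I)).re : ℝ)) =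
      Complex.exp ((w.re : ℂ) * p.1 * Complex.I) *
        Complex.exp (((-w.im : ℝ) : ℂ) * p.2 * Complex.I) := by
    rw [← Complex.exp_add]
    congr 1
    simp [Complex.mul_re]
    ring
  simp only [h1]
  rw [integral_prod_mul (fun x : ℝ => Complex.exp ((w.re : ℂ) * x * Complex.I))
    (fun y : ℝ => Complex.exp (((-w.im : ℝ) : ℂ) * y * Complex.I)), ← charFun_apply_real,
    ← charFun_apply_real, ProbabilityTheory.charFun_gaussianReal,
    ProbabilityTheory.charFun_gaussianReal, ← Complex.exp_add]
  congr 1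
  have h2 : ‖w‖ ^ 2 = w.re ^ 2 + w.im ^ 2 := by
    rw [← Complex.normSq_eq_norm_sq, Complex.normSq_apply]; ring
  rw [h2]
  push_cast
  ring

lemma integral_exp_pi_stdComplexNormal {m : ℕ} (w : Fin m → ℂ) :
    ∫ z, Complex.exp (Complex.I * (∑ k, w k * z k).re)
      ∂(Measure.pi fun _ : Fin m => stdComplexNormal) =
      Complex.exp ((-((∑ k, ‖w k‖ ^ 2) / 4) : ℝ) : ℂ) := by
  have h1 (z : Fin m → ℂ) : Complex.exp (Complex.I * ((∑ k, w k * z k).re : ℝ)) =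
      ∏ k, Complex.exp (Complex.I * ((w k * z k).re : ℝ)) := by
    rw [← Complex.exp_sum, ← Finset.mul_sum, Complex.re_sum]
    push_cast; rfl
  simp only [h1]
  rw [integral_fintype_prod_eq_prod (fun k (z : ℂ) => Complex.exp (Complex.I * ((w k * z).re : ℝ)))]
  simp only [integral_exp_stdComplexNormal]
  rw [← Complex.exp_sum]
  congr 1
  rw [Finset.sum_div]
  push_cast
  rw [Finset.sum_neg_distrib]

open scoped MatrixOrder in
lemma exists_eq_transpose_mul_self {ℓ : ℕ} {C : Matrix (Fin ℓ) (Fin ℓ) ℝ}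
    (hC : C.PosSemidef) : ∃ B : Matrix (Fin ℓ) (Fin ℓ) ℝ, C = B.transpose * B := by
  obtain ⟨X, hX, -, hXC⟩ := CFC.exists_sqrt_of_isSelfAdjoint_of_quasispectrumRestricts
    hC.isHermitian (QuasispectrumRestricts.nnreal_of_nonneg hC.nonneg)
  refine ⟨X, ?_⟩
  have h : X.transpose = X := by
    rw [← Matrix.conjTranspose_eq_transpose_of_trivial]; exact hX
  rw [h, hXC]

lemma exists_real_factorization {ℓ : ℕ} {C : Fin ℓ → Fin ℓ → ℝ} (hsymm : ∀ k l, C k l = C l k)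
    (hnn : ∀ t : Fin ℓ → ℂ, 0 ≤ (∑ k, ∑ l, conj (t k) * C k l * t l).re) :
    ∃ B : Fin ℓ → Fin ℓ → ℝ, ∀ k l, C k l = ∑ j, B j k * B j l := by
  obtain ⟨B, hB⟩ := exists_eq_transpose_mul_self (C := Matrix.of C) (by
    refine Matrix.PosSemidef.of_dotProduct_mulVec_nonneg ?_ fun x => ?_
    · ext k l
      simp [hsymm k l]
    · refine (hnn fun k => (x k : ℂ)).trans_eq ?_
      rw [← Complex.ofReal_re (star x ⬝ᵥ _)]
      congr 1
      simp only [dotProduct, Matrix.mulVec, Matrix.of_apply, Finset.mul_sum, Pi.star_apply,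
        star_trivial, Complex.conj_ofReal]
      push_cast
      refine Finset.sum_congr rfl fun k _ => Finset.sum_congr rfl fun l _ => by ring)
  refine ⟨B, fun k l => ?_⟩
  have := congrFun (congrFun hB k) l
  rwa [Matrix.mul_apply] at this

/-- Existence of centered complex Gaussian vectors, with their characteristic functions. -/
lemma exists_gaussian {ℓ : ℕ} {C : Fin ℓ → Fin ℓ → ℝ} (hsymm : ∀ k l, C k l = C l k)
    (hnn : ∀ t : Fin ℓ → ℂ, 0 ≤ (∑ k, ∑ l, conj (t k) * C k l * t l).re) :
    ∃ γ : Measure (Fin ℓ → ℂ), IsProbabilityMeasure γ ∧ ∀ t : Fin ℓ → ℂ,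
      ∫ z, Complex.exp (Complex.I * (∑ k, t k * z k).re) ∂γ =
        Complex.exp ((-((∑ k, ∑ l, t k * C k l * conj (t l)).re / 4) : ℝ) : ℂ) := by
  obtain ⟨B, hB⟩ := exists_real_factorization hsymm hnn
  have hcont : Continuous fun z : Fin ℓ → ℂ => fun k => ∑ j, (B j k : ℂ) * z j := by fun_prop
  refine ⟨(Measure.pi fun _ : Fin ℓ => stdComplexNormal).map
    fun z k => ∑ j, (B j k : ℂ) * z j,
    Measure.isProbabilityMeasure_map hcont.measurable.aemeasurable, fun t => ?_⟩
  have hc : Continuous fun z : Fin ℓ → ℂ => Complex.exp (Complex.I * (∑ k, t k * z k).re) := by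
    fun_prop
  rw [integral_map hcont.measurable.aemeasurable hc.aestronglyMeasurable]
  have h1 (z : Fin ℓ → ℂ) : ∑ k, t k * ∑ j, (B j k : ℂ) * z j =
      ∑ j, (∑ k, t k * (B j k : ℂ)) * z j := by
    simp only [Finset.mul_sum, Finset.sum_mul]
    rw [Finset.sum_comm]
    refine Finset.sum_congr rfl fun j _ => Finset.sum_congr rfl fun k _ => by ring
  simp only [h1]
  rw [integral_exp_pi_stdComplexNormal]
  have h2 : ((∑ j, ‖∑ k, t k * (B j k : ℂ)‖ ^ 2 : ℝ) : ℂ) =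
      ∑ k, ∑ l, t k * C k l * conj (t l) := by
    push_cast
    simp only [← Complex.mul_conj', map_sum, map_mul, Complex.conj_ofReal, Finset.sum_mul_sum, hB]
    push_cast
    simp only [Finset.mul_sum, Finset.sum_mul]
    rw [Finset.sum_comm]
    refine Finset.sum_congr rfl fun k _ => ?_
    rw [Finset.sum_comm]
    refine Finset.sum_congr rfl fun l _ => Finset.sum_congr rfl fun j _ => ?_
    ring
  rw [← h2, Complex.ofReal_re]

lemma complexNormal_isProbabilityMeasure (v : ℝ) : IsProbabilityMeasure (complexNormal v) :=
  Measure.isProbabilityMeasure_map (by fun_prop)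

lemma integral_exp_complexNormal {v : ℝ} (hv : 0 ≤ v) (w : ℂ) :
    ∫ z, Complex.exp (Complex.I * (w * z).re) ∂(complexNormal v) =
      Complex.exp ((-(v * ‖w‖ ^ 2 / 4) : ℝ) : ℂ) := by
  have hc : Continuous fun z : ℂ => Complex.exp (Complex.I * (w * z).re) := by fun_prop
  rw [complexNormal, integral_map (by fun_prop) hc.aestronglyMeasurable]
  simp only [← mul_assoc]
  rw [integral_exp_stdComplexNormal, norm_mul, Complex.norm_real, mul_pow,
    Real.norm_of_nonneg (Real.sqrt_nonneg _), Real.sq_sqrt hv, mul_comm v]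

/-- A measure on `ℂ` is determined by its characteristic function. -/
lemma eq_of_integral_exp {P Q : Measure ℂ} [IsProbabilityMeasure P] [IsProbabilityMeasure Q]
    (h : ∀ w : ℂ, ∫ z, Complex.exp (Complex.I * (w * z).re) ∂P =
      ∫ z, Complex.exp (Complex.I * (w * z).re) ∂Q) : P = Q := by
  refine Measure.ext_of_charFun (funext fun t => ?_)
  have h1 := h (conj t)
  have h2 (z : ℂ) : (inner ℝ z t : ℝ) = (conj t * z).re := by
    rw [Complex.inner]; simp [Complex.mul_re]
  simp only [charFun_apply, h2, mul_comm _ Complex.I, h1]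

lemma isCenteredComplexGaussianVector_of_integral_exp {ℓ : ℕ} {γ : Measure (Fin ℓ → ℂ)}
    (hγ : IsProbabilityMeasure γ) {C : Fin ℓ → Fin ℓ → ℂ} (hsymm : ∀ k l, C k l = C l k)
    (hnn : ∀ t : Fin ℓ → ℂ, 0 ≤ (∑ k, ∑ l, conj (t k) * C k l * t l).re)
    (h : ∀ t : Fin ℓ → ℂ, ∫ z, Complex.exp (Complex.I * (∑ k, t k * z k).re) ∂γ =
        Complex.exp ((-((∑ k, ∑ l, t k * C k l * conj (t l)).re / 4) : ℝ) : ℂ)) :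
    IsCenteredComplexGaussianVector γ C := by
  refine ⟨hγ, fun t => ?_⟩
  have hcont : Continuous fun z : Fin ℓ → ℂ => ∑ i, t i * z i := by fun_prop
  have : IsProbabilityMeasure (γ.map fun z => ∑ i, t i * z i) :=
    Measure.isProbabilityMeasure_map hcont.measurable.aemeasurable
  have := complexNormal_isProbabilityMeasure (∑ i, ∑ j, conj (t i) * C i j * t j).re
  refine eq_of_integral_exp fun w => ?_
  have hc : Continuous fun z : ℂ => Complex.exp (Complex.I * (w * z).re) := by fun_prop
  rw [integral_exp_complexNormal (hnn t),
    integral_map hcont.measurable.aemeasurable hc.aestronglyMeasurable]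
  simp only [Finset.mul_sum, ← mul_assoc]
  rw [h fun k => w * t k]
  have h1 : ∑ k, ∑ l, w * t k * C k l * conj (w * t l) =
      (∑ i, ∑ j, conj (t i) * C i j * t j) * ((‖w‖ ^ 2 : ℝ) : ℂ) := by
    rw [Finset.sum_comm]
    simp only [Finset.sum_mul]
    refine Finset.sum_congr rfl fun i _ => Finset.sum_congr rfl fun j _ => ?_
    push_cast
    rw [← Complex.mul_conj', map_mul, hsymm j i]
    ring
  rw [h1, Complex.re_mul_ofReal]

/-- Lévy continuity theorem for random vectors in `ℂ^ℓ`. -/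
lemma tendsto_integral_of_tendsto_charFun {ℓ : ℕ} {ν : ℕ → Measure (Fin ℓ → ℂ)}
    (hν : ∀ n, IsProbabilityMeasure (ν n)) {γ : Measure (Fin ℓ → ℂ)} (hγ : IsProbabilityMeasure γ)
    (h : ∀ t : Fin ℓ → ℂ,
      Tendsto (fun n => ∫ z, Complex.exp (Complex.I * (∑ k, conj (t k) * z k).re) ∂(ν n)) atTop
        (𝓝 (∫ z, Complex.exp (Complex.I * (∑ k, conj (t k) * z k).re) ∂γ)))
    (g : BoundedContinuousFunction (Fin ℓ → ℂ) ℝ) :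
    Tendsto (fun n => ∫ z, g z ∂(ν n)) atTop (𝓝 (∫ z, g z ∂γ)) := by
  let E := PiLp 2 fun _ : Fin ℓ => ℂ
  have hto : Continuous (WithLp.toLp 2 : (Fin ℓ → ℂ) → E) := PiLp.continuous_toLp 2 _
  have hof : Continuous (WithLp.ofLp : E → (Fin ℓ → ℂ)) := PiLp.continuous_ofLp 2 _
  have hm := hto.measurable
  have hprob (P : Measure (Fin ℓ → ℂ)) (hP : IsProbabilityMeasure P) :
      IsProbabilityMeasure (P.map (WithLp.toLp 2 : (Fin ℓ → ℂ) → E)) :=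
    Measure.isProbabilityMeasure_map hm.aemeasurable
  have hchar (P : Measure (Fin ℓ → ℂ)) (t : E) :
      charFun (P.map (WithLp.toLp 2 : (Fin ℓ → ℂ) → E)) t =
        ∫ z, Complex.exp (Complex.I * (∑ k, conj (t.ofLp k) * z k).re) ∂P := by
    have hc : Continuous fun x : E => Complex.exp ((inner ℝ x t : ℝ) * Complex.I) := by fun_prop
    rw [charFun_apply, integral_map hm.aemeasurable hc.aestronglyMeasurable]
    congr 1
    funext z
    rw [mul_comm Complex.I, PiLp.inner_apply, Complex.re_sum]
    congr 3
    refine Finset.sum_congr rfl fun k _ => ?_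
    rw [Complex.inner]
    simp [Complex.mul_re]
  let toPM (P : Measure (Fin ℓ → ℂ)) (hP : IsProbabilityMeasure P) : ProbabilityMeasure E :=
    ⟨P.map (WithLp.toLp 2 : (Fin ℓ → ℂ) → E), hprob P hP⟩
  have hlim : Tendsto (fun n => toPM (ν n) (hν n)) atTop (𝓝 (toPM γ hγ)) := by
    refine ProbabilityMeasure.tendsto_of_tendsto_charFun fun t => ?_
    simp only [toPM, ProbabilityMeasure.coe_mk, hchar]
    exact h t.ofLp
  have h1 := ProbabilityMeasure.tendsto_iff_forall_integral_tendsto.mp hlim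
    (g.compContinuous ⟨WithLp.ofLp, hof⟩)
  have h2 (P : Measure (Fin ℓ → ℂ)) :
      ∫ x, (g.compContinuous ⟨WithLp.ofLp, hof⟩) x ∂(P.map (WithLp.toLp 2 : (Fin ℓ → ℂ) → E)) =
        ∫ z, g z ∂P := by
    rw [integral_map hm.aemeasurable
      (BoundedContinuousFunction.continuous _).aestronglyMeasurable]
    rfl
  rw [← h2 γ]
  exact h1.congr fun n => h2 (ν n)

end UnitaryCLT

open UnitaryCLT

/-- Multidimensional CLT for `log Z` on the unitary group, case `ε_n ≫ 1/n`. -/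
theorem multidim_clt_unitary_eps_large
    (ℓ : ℕ) (hℓ : 1 ≤ ℓ)
    (μ : ∀ n : ℕ, Measure (Matrix.unitaryGroup (Fin n) ℂ))
    (hμprob : ∀ n, IsProbabilityMeasure (μ n))
    (hμinv : ∀ n, ∀ g : Matrix.unitaryGroup (Fin n) ℂ, (μ n).map (fun u => g * u) = μ n)
    (ε : ℕ → ℝ) (hε0 : Tendsto ε atTop (𝓝 0))
    (d : ℝ) (hd : 0 < d) (hεlb : ∀ n : ℕ, d / n ≤ ε n)
    (φ : Fin ℓ → ℕ → ℝ) (δ₀ : ℝ) (hδ₀ : 0 < δ₀)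
    (hφ0 : ∀ n i, 0 ≤ φ i n)
    (hφmono : ∀ n, StrictMono fun i => φ i n)
    (hφub : ∀ n i, φ i n < 2 * Real.pi - δ₀)
    (c : Fin ℓ → Fin ℓ → ℝ≥0∞)
    (hc : ∀ i j, i ≠ j →
      Tendsto (fun n => ((Real.log |φ j n - φ i n| / Real.log (ε n) : ℝ) : EReal))
        atTop (𝓝 (c i j))) :
    ∃ γ : Measure (Fin ℓ → ℂ),
      IsCenteredComplexGaussianVector γ
        (fun i j => if i = j then 1 else ((min (c i j) 1).toReal : ℂ)) ∧
      ∀ g : BoundedContinuousFunction (Fin ℓ → ℂ) ℝ,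
        Tendsto (fun n => ∫ u,
            g (fun k => (Real.sqrt (-Real.log (ε n)) : ℂ)⁻¹ * logZ n u (ε n) (φ k n)) ∂(μ n))
          atTop (𝓝 (∫ z, g z ∂γ)) := by
  have hεpos (n : ℕ) (hn : 1 ≤ n) : 0 < ε n := by
    have : (0 : ℝ) < n := by exact_mod_cast hn
    exact (by positivity : 0 < d / n).trans_le (hεlb n)
  have hεw : Tendsto ε atTop (𝓝[>] 0) :=
    tendsto_nhdsWithin_iff.mpr ⟨hε0, (eventually_ge_atTop 1).mono hεpos⟩
  set C : Fin ℓ → Fin ℓ → ℝ := fun i j => if i = j then 1 else (min (c i j) 1).toReal with hCdef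
  have hCeq : (fun i j => if i = j then 1 else ((min (c i j) 1).toReal : ℂ)) =
      fun i j => (C i j : ℂ) := by
    funext i j
    by_cases h : i = j <;> simp [hCdef, h]
  have hC (k l : Fin ℓ) : Tendsto
      (fun n => Real.log (max (ε n) |φ l n - φ k n|) / Real.log (ε n)) atTop (𝓝 (C k l)) := by
    by_cases h : k = l
    · subst h
      simp only [hCdef, if_true]
      refine tendsto_const_nhds.congr' ?_
      filter_upwards [eventually_neg_log_pos hεw, eventually_ge_atTop 1] with n hl hn
      rw [sub_self, abs_zero, max_eq_left (hεpos n hn).le, div_self (by linarith)]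
    · simp only [hCdef, if_neg h]
      exact tendsto_log_max_div hεw
        (fun n => sub_ne_zero.mpr ((hφmono n).injective.ne (Ne.symm h))) (hc k l h)
  have hsymm (k l : Fin ℓ) : C k l = C l k := by
    refine tendsto_nhds_unique (hC k l) ?_
    simpa only [abs_sub_comm] using hC l k
  have hnn (t : Fin ℓ → ℂ) : 0 ≤ (∑ k, ∑ l, conj (t k) * C k l * t l).re :=
    quadraticForm_nonneg hεw hδ₀ hφ0 hφub hC t
  obtain ⟨γ, hγ, hγchar⟩ := exists_gaussian hsymm hnn
  refine ⟨γ, ?_, fun g => ?_⟩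
  · rw [hCeq]
    exact isCenteredComplexGaussianVector_of_integral_exp hγ
      (fun k l => by rw [hsymm k l]) hnn hγchar
  set X : ∀ n : ℕ, U n → Fin ℓ → ℂ := fun n u k =>
    (Real.sqrt (-Real.log (ε n)) : ℂ)⁻¹ * logZ n u (ε n) (φ k n) with hX
  have hXc (n : ℕ) (hn : 1 ≤ n) : Continuous (X n) :=
    continuous_pi fun k => continuous_const.mul (continuous_logZ (hεpos n hn) (φ k n))
  have hchar (t : Fin ℓ → ℂ) := tendsto_charFun_logZ μ hμprob hμinv hεw hd hεlb hδ₀ hφ0 hφub hC t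
  have hlim := tendsto_integral_of_tendsto_charFun
    (ν := fun n => (μ (n + 1)).map (X (n + 1)))
    (fun n => have := hμprob (n + 1)
      Measure.isProbabilityMeasure_map (hXc (n + 1) (by omega)).measurable.aemeasurable)
    hγ (fun t => ?_) g
  · rw [← tendsto_add_atTop_iff_nat 1]
    refine hlim.congr fun n => ?_
    rw [integral_map (hXc (n + 1) (by omega)).measurable.aemeasurable
      g.continuous.aestronglyMeasurable]
  · have h1 := (tendsto_add_atTop_iff_nat 1).mpr (hchar t)
    rw [hγchar]
    simp only [Complex.conj_conj]
    refine h1.congr fun n => ?_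
    have hcont : Continuous fun z : Fin ℓ → ℂ =>
      Complex.exp (Complex.I * (∑ k, conj (t k) * z k).re) := by fun_prop
    rw [integral_map (hXc (n + 1) (by omega)).measurable.aemeasurable
      hcont.aestronglyMeasurable]
end

section
/- Let ε : (0,∞) → (0,∞) satisfy ε_t → 0 as t → ∞ and ε_t ≥ d/log t for some constant d > 0 and all sufficiently large t. Let (Δ_t) be bounded and strictly positive with log Δ_t / log ε_t → c ∈ [0,∞] as t → ∞. Then (1/(−log ε_t)) · Σ_{p ≤ t} p^{i Δ_t} / p^{1+2ε_t} converges, as t → ∞, to min(c,1), where the sum runs over primes p ≤ t. -/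
open Filter
open scoped ENNReal Topology

/-- The indicator function of the primes, as a complex-valued arithmetic function. -/
noncomputable def primeIndicator (n : ℕ) : ℂ := if n.Prime then 1 else 0

lemma abscissaOfAbsConv_primeIndicator_le_one :
    LSeries.abscissaOfAbsConv primeIndicator ≤ 1 :=
  LSeries.abscissaOfAbsConv_le_of_le_const
    ⟨1, fun n _ ↦ by unfold primeIndicator; split_ifs <;> simp⟩

lemma abscissaOfAbsConv_primeIndicator_lt {s : ℂ} (hs : 1 < s.re) :
    LSeries.abscissaOfAbsConv primeIndicator < s.re :=
  abscissaOfAbsConv_primeIndicator_le_one.trans_lt (by exact_mod_cast hs)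

lemma logMul_primeIndicator (n : ℕ) :
    LSeries.logMul primeIndicator n = if n.Prime then (Real.log n : ℂ) else 0 := by
  simp [LSeries.logMul, primeIndicator]

lemma exists_norm_LSeries_vonMangoldt_sub_le :
    ∃ C, ∀ s : ℂ, 1 < s.re →
      ‖LSeries (fun n ↦ (ArithmeticFunction.vonMangoldt n : ℂ)) s
        - LSeries (LSeries.logMul primeIndicator) s‖ ≤ C := by
  have hsum := ArithmeticFunction.vonMangoldt.summable_residueClass_non_primes_div (0 : ZMod 1)
  refine ⟨∑' n : ℕ, (if n.Prime then 0 else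
    ArithmeticFunction.vonMangoldt.residueClass (0 : ZMod 1) n) / n, fun s hs ↦ ?_⟩
  rw [← LSeries_sub (ArithmeticFunction.LSeriesSummable_vonMangoldt hs)
    (LSeriesSummable_logMul_of_lt_re (abscissaOfAbsConv_primeIndicator_lt hs))]
  refine tsum_of_norm_bounded hsum.hasSum fun n ↦ ?_
  rcases eq_or_ne n 0 with rfl | hn
  · simp
  have hn1 : (1 : ℝ) ≤ n := by exact_mod_cast Nat.one_le_iff_ne_zero.mpr hn
  rw [LSeries.term_of_ne_zero hn, Pi.sub_apply, logMul_primeIndicator, norm_div,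
    Complex.norm_natCast_cpow_of_pos (Nat.pos_of_ne_zero hn)]
  have hle : (n : ℝ) ≤ (n : ℝ) ^ s.re := by
    simpa using Real.rpow_le_rpow_of_exponent_le hn1 hs.le
  split_ifs with hp
  · simp [ArithmeticFunction.vonMangoldt_apply_prime hp]
  · simp only [sub_zero, Complex.norm_real, Real.norm_eq_abs,
      abs_of_nonneg ArithmeticFunction.vonMangoldt_nonneg]
    rw [ArithmeticFunction.vonMangoldt.residueClass,
      Set.indicator_of_mem (show n ∈ {n : ℕ | (n : ZMod 1) = 0} from Subsingleton.elim _ _)]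
    have := ArithmeticFunction.vonMangoldt_nonneg (n := n)
    gcongr

lemma exists_norm_LSeries_logMul_primeIndicator_sub_le (M : ℝ) :
    ∃ C, ∀ s : ℂ, 1 < s.re → s.re ≤ 3 → |s.im| ≤ M →
      ‖LSeries (LSeries.logMul primeIndicator) s - 1 / (s - 1)‖ ≤ C := by
  obtain ⟨C₁, hC₁⟩ := exists_norm_LSeries_vonMangoldt_sub_le
  have hK : IsCompact (Set.Icc (1 : ℝ) 3 ×ℂ Set.Icc (-M) M) :=
    isCompact_Icc.reProdIm isCompact_Icc
  obtain ⟨C₂, hC₂⟩ := hK.exists_bound_of_continuousOn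
    ((ArithmeticFunction.vonMangoldt.continuousOn_LFunctionResidueClassAux (0 : ZMod 1)).mono
      fun s hs ↦ (Complex.mem_reProdIm.mp hs).1.1)
  refine ⟨C₁ + C₂, fun s hs hs3 hsM ↦ ?_⟩
  have h₁ := hC₁ s hs
  have h₂ := hC₂ s (Complex.mem_reProdIm.mpr ⟨⟨hs.le, hs3⟩, abs_le.mp hsM⟩)
  have hcoe : (fun n ↦ (ArithmeticFunction.vonMangoldt.residueClass (0 : ZMod 1) n : ℂ))
      = fun n ↦ (ArithmeticFunction.vonMangoldt n : ℂ) := by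
    ext n
    rw [ArithmeticFunction.vonMangoldt.residueClass,
      Set.indicator_of_mem (show n ∈ {n : ℕ | (n : ZMod 1) = 0} from Subsingleton.elim _ _)]
  rw [ArithmeticFunction.vonMangoldt.eqOn_LFunctionResidueClassAux
    (by rw [Subsingleton.elim (0 : ZMod 1) 1]; exact isUnit_one) hs] at h₂
  simp only [hcoe, Nat.totient_one, Nat.cast_one, inv_one] at h₂
  rw [norm_sub_rev] at h₁
  refine le_trans (le_of_eq ?_) ((norm_add_le _ _).trans (add_le_add h₁ h₂))
  congr 1
  ring

lemma exists_norm_LSeries_primeIndicator_add_log_le (M : ℝ) :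
    ∃ C, ∀ s : ℂ, 1 < s.re → s.re ≤ 3 → |s.im| ≤ M →
      ‖LSeries primeIndicator s + Complex.log (s - 1)‖ ≤ C := by
  obtain ⟨C, hC⟩ := exists_norm_LSeries_logMul_primeIndicator_sub_le M
  let f : ℂ → ℂ := fun s ↦ LSeries primeIndicator s + Complex.log (s - 1)
  let S : Set ℂ := Set.Ioc (1 : ℝ) 3 ×ℂ Set.Icc (-M) M
  have hderiv : ∀ s ∈ S, HasDerivWithinAt f
      (-(LSeries (LSeries.logMul primeIndicator) s - 1 / (s - 1))) S s := by
    intro s hs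
    have hs1 : 1 < s.re := (Complex.mem_reProdIm.mp hs).1.1
    have h := (LSeries_hasDerivAt (abscissaOfAbsConv_primeIndicator_lt hs1)).add
      (((hasDerivAt_id s).sub_const 1).clog (Or.inl (by simpa using hs1)))
    refine (h.congr_deriv ?_).hasDerivWithinAt
    simp only [id]
    ring
  have hconv : Convex ℝ S := ((convex_Ioc (1 : ℝ) 3).linear_preimage Complex.reLm).inter
    ((convex_Icc (-M) M).linear_preimage Complex.imLm)
  refine ⟨‖f 3‖ + C * (2 + M), fun s hs hs3 hsM ↦ ?_⟩
  have hM : 0 ≤ M := (abs_nonneg _).trans hsM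
  have hsS : s ∈ S := Complex.mem_reProdIm.mpr ⟨⟨hs, hs3⟩, abs_le.mp hsM⟩
  have h3S : (3 : ℂ) ∈ S := Complex.mem_reProdIm.mpr (by simp [hM])
  have hC0 : 0 ≤ C := (norm_nonneg _).trans (hC s hs hs3 hsM)
  have key := hconv.norm_image_sub_le_of_norm_hasDerivWithin_le hderiv
    (fun x hx ↦ by
      rw [norm_neg]
      exact hC x hx.1.1 hx.1.2 (abs_le.mpr hx.2)) h3S hsS
  have hdist : ‖s - 3‖ ≤ 2 + M := by
    refine (Complex.norm_le_abs_re_add_abs_im _).trans (add_le_add ?_ (by simpa using hsM))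
    simp only [Complex.sub_re, Complex.re_ofNat]
    rw [abs_le]
    constructor <;> linarith
  calc ‖f s‖ = ‖f 3 + (f s - f 3)‖ := by congr 1; ring
    _ ≤ ‖f 3‖ + ‖f s - f 3‖ := norm_add_le _ _
    _ ≤ _ := by gcongr; exact key.trans (by gcongr)

lemma norm_LSeries_primeIndicator_sub_sum_le {t : ℝ} (ht : 1 < t) {s : ℂ} (hs : 1 < s.re) :
    ‖LSeries primeIndicator s
      - ∑ p ∈ Finset.filter Nat.Prime (Finset.range (⌊t⌋₊ + 1)), 1 / (p : ℂ) ^ s‖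
      ≤ ‖LSeries (LSeries.logMul primeIndicator) s.re‖ / Real.log t := by
  have hlog : 0 < Real.log t := Real.log_pos ht
  have hsum : LSeriesSummable primeIndicator s :=
    LSeriesSummable_of_abscissaOfAbsConv_lt_re (abscissaOfAbsConv_primeIndicator_lt hs)
  have hsumlog : LSeriesSummable (LSeries.logMul primeIndicator) (s.re : ℂ) :=
    LSeriesSummable_logMul_of_lt_re (abscissaOfAbsConv_primeIndicator_lt (by simpa using hs))
  have hterm (n : ℕ) : LSeries.term (LSeries.logMul primeIndicator) (s.re : ℂ) n
      = ((if n.Prime then Real.log n / (n : ℝ) ^ s.re else 0 : ℝ) : ℂ) := by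
    rcases eq_or_ne n 0 with rfl | hn
    · simp
    rw [LSeries.term_of_ne_zero hn, logMul_primeIndicator]
    split_ifs
    · push_cast [Complex.ofReal_cpow (Nat.cast_nonneg n)]
      rfl
    · simp
  have hpartial : ∑ p ∈ Finset.filter Nat.Prime (Finset.range (⌊t⌋₊ + 1)), 1 / (p : ℂ) ^ s
      = ∑ n ∈ Finset.range (⌊t⌋₊ + 1), LSeries.term primeIndicator s n := by
    rw [Finset.sum_filter]
    refine Finset.sum_congr rfl fun n _ ↦ ?_
    rcases eq_or_ne n 0 with rfl | hn
    · simp [Nat.not_prime_zero]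
    rw [LSeries.term_of_ne_zero hn, primeIndicator]
    split_ifs <;> simp
  have hreal : Summable fun n : ℕ ↦ (if n.Prime then Real.log n / (n : ℝ) ^ s.re else 0 : ℝ) := by
    rw [← Complex.summable_ofReal]
    exact hsumlog.congr hterm
  have hnonneg (n : ℕ) : 0 ≤ (if n.Prime then Real.log n / (n : ℝ) ^ s.re else 0 : ℝ) := by
    split_ifs
    · exact div_nonneg (Real.log_natCast_nonneg n) (by positivity)
    · rfl
  have hval : ‖LSeries (LSeries.logMul primeIndicator) s.re‖
      = ∑' n : ℕ, (if n.Prime then Real.log n / (n : ℝ) ^ s.re else 0 : ℝ) := by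
    rw [LSeries, tsum_congr hterm, ← Complex.ofReal_tsum, Complex.norm_real, Real.norm_eq_abs,
      abs_of_nonneg (tsum_nonneg hnonneg)]
  rw [hpartial, LSeries, ← Summable.sum_add_tsum_nat_add (⌊t⌋₊ + 1) hsum, add_sub_cancel_left,
    hval, ← Summable.sum_add_tsum_nat_add (⌊t⌋₊ + 1) hreal]
  have htail := (summable_nat_add_iff (⌊t⌋₊ + 1)).mpr hreal
  refine (tsum_of_norm_bounded (htail.div_const (Real.log t)).hasSum fun n ↦ ?_).trans ?_
  · have hm : t < (n + (⌊t⌋₊ + 1) : ℕ) := by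
      have := Nat.lt_floor_add_one t
      push_cast
      have : (0 : ℝ) ≤ n := n.cast_nonneg
      linarith
    generalize n + (⌊t⌋₊ + 1) = m at hm
    have hm0 : m ≠ 0 := by rintro rfl; norm_num at hm; linarith
    rw [LSeries.term_of_ne_zero hm0, primeIndicator, norm_div,
      Complex.norm_natCast_cpow_of_pos (Nat.pos_of_ne_zero hm0)]
    split_ifs
    · have : Real.log t ≤ Real.log m := Real.log_le_log (by linarith) hm.le
      rw [norm_one, div_right_comm]
      gcongr
      rwa [one_le_div hlog]
    · simp
  · rw [tsum_div_const]
    gcongr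
    exact le_add_of_nonneg_left (Finset.sum_nonneg fun n _ ↦ hnonneg n)

lemma exists_norm_sum_add_log_le {ε Δ : ℝ → ℝ} (hεpos : ∀ t, 0 < ε t)
    (hε0 : Tendsto ε atTop (𝓝 0)) {d : ℝ} (hd : 0 < d)
    (hεlb : ∀ᶠ t in atTop, d / Real.log t ≤ ε t) {M : ℝ} (hΔ : ∀ t, |Δ t| ≤ M) :
    ∃ C, ∀ᶠ t in atTop,
      ‖∑ p ∈ Finset.filter Nat.Prime (Finset.range (⌊t⌋₊ + 1)),
          (p : ℂ) ^ (Complex.I * Δ t) / (p : ℂ) ^ ((1 : ℂ) + 2 * ε t)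
        + Complex.log (2 * ε t - Complex.I * Δ t)‖ ≤ C := by
  obtain ⟨C₁, hC₁⟩ := exists_norm_LSeries_primeIndicator_add_log_le M
  obtain ⟨C₂, hC₂⟩ := exists_norm_LSeries_logMul_primeIndicator_sub_le 0
  refine ⟨C₁ + (C₂ + (2 * d)⁻¹), ?_⟩
  filter_upwards [hεlb, hε0.eventually_le_const one_pos, eventually_ge_atTop (Real.exp 1)]
    with t ht hε1 hte
  have hε := hεpos t
  have hlog : 1 ≤ Real.log t := by rwa [Real.le_log_iff_exp_le ((Real.exp_pos 1).trans_le hte)]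
  have ht1 : 1 < t := (Real.one_lt_exp_iff.mpr one_pos).trans_le hte
  set s : ℂ := 1 + 2 * ε t - Complex.I * Δ t with hs
  have hre : s.re = 1 + 2 * ε t := by simp [hs]
  have him : s.im = -Δ t := by simp [hs]
  have hs1 : 1 < s.re := by linarith
  have hsum : ∑ p ∈ Finset.filter Nat.Prime (Finset.range (⌊t⌋₊ + 1)),
          (p : ℂ) ^ (Complex.I * Δ t) / (p : ℂ) ^ ((1 : ℂ) + 2 * ε t)
      = ∑ p ∈ Finset.filter Nat.Prime (Finset.range (⌊t⌋₊ + 1)), 1 / (p : ℂ) ^ s := by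
    refine Finset.sum_congr rfl fun p hp ↦ ?_
    have hp0 : (p : ℂ) ≠ 0 := by exact_mod_cast (Finset.mem_filter.mp hp).2.ne_zero
    rw [← Complex.cpow_sub _ _ hp0, one_div, ← Complex.cpow_neg]
    congr 1
    rw [hs]
    ring
  have h₁ := hC₁ s hs1 (by linarith) (by rw [him, abs_neg]; exact hΔ t)
  have h₂ := norm_LSeries_primeIndicator_sub_sum_le ht1 hs1
  have h₃ := hC₂ s.re (by simpa using hs1) (by simp; linarith) (by simp)
  have h₄ : ‖(1 : ℂ) / (s.re - 1)‖ = (2 * ε t)⁻¹ := by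
    rw [hre]
    simp [abs_of_pos hε]
  have hC₂0 : 0 ≤ C₂ := (norm_nonneg _).trans h₃
  have h₅ : ‖LSeries (LSeries.logMul primeIndicator) s.re‖ ≤ C₂ + (2 * ε t)⁻¹ := by
    rw [← h₄]
    refine le_trans ?_ (add_le_add_left h₃ _)
    exact norm_le_norm_sub_add _ _
  have h₆ : ‖LSeries (LSeries.logMul primeIndicator) s.re‖ / Real.log t ≤ C₂ + (2 * d)⁻¹ := by
    have hdε : d ≤ ε t * Real.log t := (div_le_iff₀ (by linarith)).mp ht
    calc _ ≤ (C₂ + (2 * ε t)⁻¹) / Real.log t := by gcongr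
      _ = C₂ / Real.log t + (2 * (ε t * Real.log t))⁻¹ := by
        field_simp
      _ ≤ C₂ + (2 * d)⁻¹ := by
        gcongr
        exact div_le_self hC₂0 hlog
  have hz : (2 * ε t - Complex.I * Δ t : ℂ) = s - 1 := by rw [hs]; ring
  rw [hsum, hz]
  refine le_trans (le_of_eq ?_) ((norm_sub_le _ _).trans (add_le_add h₁ (h₂.trans h₆)))
  congr 1
  ring

lemma tendsto_min_one_toReal {α : Type*} {l : Filter α} {r : α → ℝ} {c : ℝ≥0∞}
    (h : Tendsto (fun a ↦ (r a : EReal)) l (𝓝 c)) :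
    Tendsto (fun a ↦ min (r a) 1) l (𝓝 (min c 1).toReal) := by
  have h₁ : Tendsto (fun a ↦ min (r a : EReal) 1) l (𝓝 (min (c : EReal) 1)) :=
    h.min tendsto_const_nhds
  have hne : min c 1 ≠ ⊤ := ne_top_of_le_ne_top ENNReal.one_ne_top (min_le_right _ _)
  have hmin : min (c : EReal) 1 = (((min c 1).toReal : ℝ) : EReal) := by
    rw [EReal.coe_ennreal_toReal hne]
    exact (EReal.coe_ennreal_strictMono.monotone.map_min (a := c) (b := 1)).symm
  rw [hmin] at h₁
  rw [← EReal.tendsto_coe]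
  refine h₁.congr fun a ↦ ?_
  exact (EReal.coe_strictMono.monotone.map_min (a := r a) (b := 1)).symm

/-- `log ‖2ε - iΔ‖` is, up to a bounded error, `log ε` times `min (log Δ / log ε) 1`. -/
lemma abs_log_norm_sub_le {ε Δ : ℝ} (hε : 0 < ε) (hε1 : ε < 1) (hΔ : 0 < Δ) :
    |Real.log ‖(2 * ε - Complex.I * Δ : ℂ)‖
      - Real.log ε * min (Real.log Δ / Real.log ε) 1| ≤ Real.log 3 := by
  have hlogε : Real.log ε < 0 := Real.log_neg hε hε1
  have hmax : Real.log ε * min (Real.log Δ / Real.log ε) 1 = Real.log (max Δ ε) := by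
    rw [← smul_eq_mul, smul_min_of_nonpos hlogε.le, smul_eq_mul, smul_eq_mul, mul_div_cancel₀ _ hlogε.ne, mul_one]
    rcases le_total Δ ε with h | h
    · rw [max_eq_right h, max_eq_right (Real.log_le_log hΔ h)]
    · rw [max_eq_left h, max_eq_left (Real.log_le_log hε h)]
  have hmaxpos : 0 < max Δ ε := lt_max_of_lt_left hΔ
  have hlow : max Δ ε ≤ ‖(2 * ε - Complex.I * Δ : ℂ)‖ := by
    refine max_le ?_ ?_
    · simpa [abs_of_pos hΔ] using Complex.abs_im_le_norm (2 * ε - Complex.I * Δ : ℂ)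
    · have := Complex.abs_re_le_norm (2 * ε - Complex.I * Δ : ℂ)
      simp [abs_of_pos hε] at this
      linarith
  have hupp : ‖(2 * ε - Complex.I * Δ : ℂ)‖ ≤ 3 * max Δ ε := by
    refine (norm_sub_le _ _).trans ?_
    simp only [Complex.norm_mul, Complex.norm_ofNat, Complex.norm_real, Real.norm_eq_abs,
      abs_of_pos hε, Complex.norm_I, one_mul, abs_of_pos hΔ]
    linarith [le_max_left Δ ε, le_max_right Δ ε]
  rw [hmax, abs_of_nonneg (sub_nonneg.mpr (Real.log_le_log hmaxpos hlow)), sub_le_iff_le_add,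
    ← Real.log_mul three_ne_zero hmaxpos.ne']
  exact Real.log_le_log (hmaxpos.trans_le hlow) hupp


/-- Lemma 5 of the paper: for `ε_t ≫ 1/log t`, `ε_t → 0`, `Δ_t` bounded and positive with
`log Δ_t / log ε_t → c`, we have `(1/(-log ε_t)) ∑_{p ≤ t} p^{iΔ_t}/p^{1+2ε_t} → min(c,1)`. -/
theorem prime_sum_asymptotics_eps_large
    (ε : ℝ → ℝ) (hεpos : ∀ t, 0 < ε t) (hε0 : Tendsto ε atTop (𝓝 0))
    (d : ℝ) (hd : 0 < d) (hεlb : ∀ᶠ t in atTop, d / Real.log t ≤ ε t)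
    (Δ : ℝ → ℝ) (hΔpos : ∀ t, 0 < Δ t) (M : ℝ) (hΔub : ∀ t, Δ t ≤ M)
    (c : ℝ≥0∞)
    (hc : Tendsto (fun t => ((Real.log (Δ t) / Real.log (ε t) : ℝ) : EReal))
      atTop (𝓝 c)) :
    Tendsto (fun t => ((-Real.log (ε t))⁻¹ : ℂ) *
        ∑ p ∈ Finset.filter Nat.Prime (Finset.range (⌊t⌋₊ + 1)),
          (p : ℂ) ^ (Complex.I * Δ t) / (p : ℂ) ^ ((1 : ℂ) + 2 * ε t))
      atTop (𝓝 (((min c 1).toReal : ℂ))) := by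
  obtain ⟨C, hC⟩ := exists_norm_sum_add_log_le (Δ := Δ) hεpos hε0 hd hεlb
    fun t ↦ (abs_of_pos (hΔpos t)).trans_le (hΔub t)
  have hmain : Tendsto (fun t ↦ ((min (Real.log (Δ t) / Real.log (ε t)) 1 : ℝ) : ℂ)) atTop
      (𝓝 ((min c 1).toReal : ℂ)) :=
    (Complex.continuous_ofReal.tendsto _).comp (tendsto_min_one_toReal hc)
  have hlog : Tendsto (fun t ↦ -Real.log (ε t)) atTop atTop :=
    tendsto_neg_atBot_atTop.comp <| Real.tendsto_log_nhdsGT_zero.comp <|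
      tendsto_nhdsWithin_iff.mpr ⟨hε0, Eventually.of_forall hεpos⟩
  have herr : Tendsto (fun t ↦ (-Real.log (ε t))⁻¹ * (C + (Real.log 3 + Real.pi))) atTop (𝓝 0) := by
    simpa using hlog.inv_tendsto_atTop.mul_const (C + (Real.log 3 + Real.pi))
  refine (tendsto_iff_of_dist ?_).mp hmain
  refine squeeze_zero' (Eventually.of_forall fun _ ↦ dist_nonneg) ?_ herr
  filter_upwards [hC, hε0.eventually_lt_const one_pos] with t ht hε1
  have hlogε : Real.log (ε t) < 0 := Real.log_neg (hεpos t) hε1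
  have hlogC : (Real.log (ε t) : ℂ) ≠ 0 := by exact_mod_cast hlogε.ne
  set S := ∑ p ∈ Finset.filter Nat.Prime (Finset.range (⌊t⌋₊ + 1)),
    (p : ℂ) ^ (Complex.I * Δ t) / (p : ℂ) ^ ((1 : ℂ) + 2 * ε t)
  set z : ℂ := 2 * ε t - Complex.I * Δ t with hz
  set m : ℝ := min (Real.log (Δ t) / Real.log (ε t)) 1 with hm
  have hre : |(Complex.log z - Real.log (ε t) * m).re| ≤ Real.log 3 := by
    simpa [Complex.log_re] using abs_log_norm_sub_le (hεpos t) hε1 (hΔpos t)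
  have him : |(Complex.log z - Real.log (ε t) * m).im| ≤ Real.pi := by
    simpa [Complex.log_im] using Complex.abs_arg_le_pi z
  have hsplit : (-Real.log (ε t) : ℂ)⁻¹ * S - m
      = (-Real.log (ε t) : ℂ)⁻¹ * ((S + Complex.log z) - (Complex.log z - Real.log (ε t) * m)) := by
    field_simp
    ring
  rw [dist_comm, dist_eq_norm, hsplit, norm_mul, norm_inv, norm_neg, Complex.norm_real,
    Real.norm_eq_abs, abs_of_neg hlogε]
  have := neg_pos.mpr hlogε
  gcongr
  refine (norm_sub_le _ _).trans (add_le_add ht ?_)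
  exact (Complex.norm_le_abs_re_add_abs_im _).trans (add_le_add hre him)
end
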